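/- Let k be an algebraically closed field of characteristic 0 and q ∈ k^×. In the free algebra k⟨x_1,x_2,x_3⟩ define x_13 := x_1x_3 − q·x_3x_1, x_23 := x_2x_3 − q·x_3x_2, x_31 := x_3x_1 + q^{−1}·x_1x_3, x_213 := x_2·x_13 + q·x_13·x_2, and u := x_23·x_13 + x_13·x_23. Let A be the quotient of k⟨x_1,x_2,x_3⟩ by the two-sided ideal generated by: x_1², x_2², x_1x_2 + x_2x_1, x_3², x_31², x_213², and x_2·u − q²·u·x_2 − q·x_13·x_213. Then the images of the monomials x_2^{m_1}·x_23^{m_2}·x_213^{m_3}·u^{m_4}·x_1^{m_5}·x_13^{m_6}·x_3^{m_7}, with m_1, m_3, m_5, m_6, m_7 ∈ {0,1} and m_2, m_4 ∈ ℕ, form a k-basis of A, and GKdim A = 2. (A is the Endymion Nichols algebra B(eny_*(q)) of a pale block and a point with q_22 = −1 and mild interaction.) -/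

import Mathlib

open scoped ENNReal

/-- The Gelfand–Kirillov dimension of a `k`-algebra `A`. -/
noncomputable def GKdim (k A : Type*) [Field k] [Ring A] [Algebra k A] : ℝ≥0∞ :=
  ⨆ (V : Submodule k A) (_ : FiniteDimensional k V),
    Filter.limsup
      (fun n : ℕ =>
        ENNReal.ofReal
          (Real.log ((Module.finrank k (↥(∑ j ∈ Finset.range (n + 1), V ^ j)) : ℕ) : ℝ) /
            Real.log (n : ℝ)))
      Filter.atTop

/-- The generator `x_{i+1}` of the free algebra `k⟨x₁,x₂,x₃⟩`. -/
noncomputable def X (k : Type*) [Field k] (i : Fin 3) : FreeAlgebra k (Fin 3) :=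
  FreeAlgebra.ι k i

/-- `x₁₃ := x₁x₃ − q x₃x₁`. -/
noncomputable def x13 (k : Type*) [Field k] (q : k) : FreeAlgebra k (Fin 3) :=
  X k 0 * X k 2 - q • (X k 2 * X k 0)

/-- `x₂₃ := x₂x₃ − q x₃x₂`. -/
noncomputable def x23 (k : Type*) [Field k] (q : k) : FreeAlgebra k (Fin 3) :=
  X k 1 * X k 2 - q • (X k 2 * X k 1)

/-- `x₃₁ := x₃x₁ + q⁻¹ x₁x₃`. -/
noncomputable def x31 (k : Type*) [Field k] (q : k) : FreeAlgebra k (Fin 3) :=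
  X k 2 * X k 0 + q⁻¹ • (X k 0 * X k 2)

/-- `x₂₁₃ := x₂ x₁₃ + q x₁₃ x₂`. -/
noncomputable def x213 (k : Type*) [Field k] (q : k) : FreeAlgebra k (Fin 3) :=
  X k 1 * x13 k q + q • (x13 k q * X k 1)

/-- `u := x₂₃x₁₃ + x₁₃x₂₃`. -/
noncomputable def uu (k : Type*) [Field k] (q : k) : FreeAlgebra k (Fin 3) :=
  x23 k q * x13 k q + x13 k q * x23 k q

/-- The defining relations of the Endymion algebra `B(eny⋆(q))`. -/
def enyRel (k : Type*) [Field k] (q : k)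
    (a b : FreeAlgebra k (Fin 3)) : Prop :=
  b = 0 ∧
    (a = X k 0 * X k 0 ∨
     a = X k 1 * X k 1 ∨
     a = X k 0 * X k 1 + X k 1 * X k 0 ∨
     a = X k 2 * X k 2 ∨
     a = x31 k q * x31 k q ∨
     a = x213 k q * x213 k q ∨
     a = X k 1 * uu k q - (q ^ 2) • (uu k q * X k 1) - q • (x13 k q * x213 k q))

/-- The PBW monomials `x₂^{m₁} x₂₃^{m₂} x₂₁₃^{m₃} u^{m₄} x₁^{m₅} x₁₃^{m₆} x₃^{m₇}`,
`m₁, m₃, m₅, m₆, m₇ ∈ {0,1}`, `m₂, m₄ ∈ ℕ`. -/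
noncomputable def bas (k : Type*) [Field k] (q : k)
    (p : Fin 2 × ℕ × Fin 2 × ℕ × Fin 2 × Fin 2 × Fin 2) : RingQuot (enyRel k q) :=
  RingQuot.mkAlgHom k (enyRel k q)
    (X k 1 ^ ((p.1 : ℕ)) * x23 k q ^ p.2.1 * x213 k q ^ ((p.2.2.1 : ℕ)) *
      uu k q ^ p.2.2.2.1 * X k 0 ^ ((p.2.2.2.2.1 : ℕ)) *
      x13 k q ^ ((p.2.2.2.2.2.1 : ℕ)) * X k 2 ^ ((p.2.2.2.2.2.2 : ℕ)))

set_option linter.unusedSimpArgs false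

/-- The exponents of the PBW monomials. -/
abbrev PBWIndex : Type := Fin 2 × ℕ × Fin 2 × ℕ × Fin 2 × Fin 2 × Fin 2

/-- The basis vector with the given exponents; it is `0` when one of the exponents of a
square-zero generator exceeds `1`. -/
noncomputable def pbwVec (k : Type*) [Field k] (m₁ m₂ m₃ m₄ m₅ m₆ m₇ : ℕ) : PBWIndex →₀ k :=
  if h : m₁ < 2 ∧ m₃ < 2 ∧ m₅ < 2 ∧ m₆ < 2 ∧ m₇ < 2 then
    Finsupp.single (⟨m₁, h.1⟩, m₂, ⟨m₃, h.2.1⟩, m₄, ⟨m₅, h.2.2.1⟩, ⟨m₆, h.2.2.2.1⟩,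
      ⟨m₇, h.2.2.2.2⟩) 1
  else 0

section RightRegular

variable {k : Type*} [Field k] (q : k)

/-- Formula for right multiplication by `x₁` on a PBW monomial. -/
noncomputable def mulX1Fun (m₁ m₂ m₃ m₄ m₅ m₆ m₇ : ℕ) : PBWIndex →₀ k :=
  (q⁻¹ ^ m₇ * (-q⁻¹) ^ m₆) • pbwVec k m₁ m₂ m₃ m₄ (m₅ + 1) m₆ m₇
    - ((m₇ : k) * q⁻¹) • pbwVec k m₁ m₂ m₃ m₄ m₅ (m₆ + 1) (m₇ - 1)

/-- Formula for right multiplication by `x₂₃` on a PBW monomial not involving `x₃`, the exponent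
of `x₃` being carried along. -/
noncomputable def mulX23Fun (m₁ m₂ m₃ m₄ m₅ m₆ m₇ : ℕ) : PBWIndex →₀ k :=
  ((m₆ : k) * q ^ (2 * m₅)) • pbwVec k m₁ m₂ m₃ (m₄ + 1) m₅ (m₆ - 1) m₇
    - ((-1) ^ m₆ * (m₅ : k) * q⁻¹ ^ (2 * m₄)) • pbwVec k m₁ m₂ (m₃ + 1) m₄ (m₅ - 1) m₆ m₇
    + ((m₄ : k) + (m₃ : k)) • pbwVec k m₁ m₂ m₃ m₄ m₅ (m₆ + 1) m₇
    + ((-1) ^ m₆ * (-q) ^ m₅ * q ^ m₃) • pbwVec k m₁ (m₂ + 1) m₃ m₄ m₅ m₆ m₇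

/-- Formula for right multiplication by `x₂` on a PBW monomial. -/
noncomputable def mulX2Fun (m₁ m₂ m₃ m₄ m₅ m₆ m₇ : ℕ) : PBWIndex →₀ k :=
  (q⁻¹ ^ m₇ * ((m₆ : k) * q⁻¹ * q ^ m₅ * q⁻¹ ^ (2 * m₄))) •
      pbwVec k m₁ m₂ (m₃ + 1) m₄ m₅ (m₆ - 1) m₇
    - (q⁻¹ ^ m₇ * ((m₄ : k) * q⁻¹ ^ (2 * m₄) * q⁻¹ ^ m₅)) •
      pbwVec k m₁ m₂ (m₃ + 1) (m₄ - 1) m₅ (m₆ + 1) m₇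
    + (q⁻¹ ^ m₇ * ((-q⁻¹) ^ m₆ * (-1) ^ m₅ * q⁻¹ ^ (2 * m₄) * q⁻¹ ^ m₃ * ((-1) ^ m₂ * q⁻¹ ^ m₂))) •
      pbwVec k (m₁ + 1) m₂ m₃ m₄ m₅ m₆ m₇
    - ((m₇ : k) * q⁻¹) • mulX23Fun q m₁ m₂ m₃ m₄ m₅ m₆ (m₇ - 1)

/-- Extend a function of the seven exponents linearly to the span of the PBW monomials. -/
noncomputable def pbwLift (f : ℕ → ℕ → ℕ → ℕ → ℕ → ℕ → ℕ → (PBWIndex →₀ k)) :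
    Module.End k (PBWIndex →₀ k) :=
  Finsupp.linearCombination k fun p : PBWIndex =>
    f p.1 p.2.1 p.2.2.1 p.2.2.2.1 p.2.2.2.2.1 p.2.2.2.2.2.1 p.2.2.2.2.2.2

theorem pbwLift_pbwVec (f : ℕ → ℕ → ℕ → ℕ → ℕ → ℕ → ℕ → (PBWIndex →₀ k))
    (m₁ m₂ m₃ m₄ m₅ m₆ m₇ : ℕ) (h₁ : m₁ < 2) (h₃ : m₃ < 2) (h₅ : m₅ < 2) (h₆ : m₆ < 2)
    (h₇ : m₇ < 2) :
    pbwLift f (pbwVec k m₁ m₂ m₃ m₄ m₅ m₆ m₇) = f m₁ m₂ m₃ m₄ m₅ m₆ m₇ := by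
  simp [pbwLift, pbwVec, h₁, h₃, h₅, h₆, h₇]

theorem single_eq_pbwVec (p : PBWIndex) :
    Finsupp.single p (1 : k) =
      pbwVec k p.1 p.2.1 p.2.2.1 p.2.2.2.1 p.2.2.2.2.1 p.2.2.2.2.2.1 p.2.2.2.2.2.2 := by
  obtain ⟨a, b, c, d, e, f, g⟩ := p
  simp only [pbwVec, Fin.is_lt, and_self, dite_true, Fin.eta]

theorem end_ext_pbwVec {S T : Module.End k (PBWIndex →₀ k)}
    (h : ∀ m₁ m₂ m₃ m₄ m₅ m₆ m₇ : ℕ, m₁ < 2 → m₃ < 2 → m₅ < 2 → m₆ < 2 → m₇ < 2 →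
      S (pbwVec k m₁ m₂ m₃ m₄ m₅ m₆ m₇) = T (pbwVec k m₁ m₂ m₃ m₄ m₅ m₆ m₇)) : S = T := by
  refine Finsupp.lhom_ext' fun p => LinearMap.ext_ring ?_
  simp only [LinearMap.comp_apply, Finsupp.lsingle_apply, single_eq_pbwVec]
  exact h _ _ _ _ _ _ _ p.1.2 p.2.2.1.2 p.2.2.2.2.1.2 p.2.2.2.2.2.1.2 p.2.2.2.2.2.2.2

@[simp] theorem pbwVec_two₁ (b c d e f g : ℕ) : pbwVec k 2 b c d e f g = 0 := by simp [pbwVec]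
@[simp] theorem pbwVec_two₃ (a b d e f g : ℕ) : pbwVec k a b 2 d e f g = 0 := by simp [pbwVec]
@[simp] theorem pbwVec_two₅ (a b c d f g : ℕ) : pbwVec k a b c d 2 f g = 0 := by simp [pbwVec]
@[simp] theorem pbwVec_two₆ (a b c d e g : ℕ) : pbwVec k a b c d e 2 g = 0 := by simp [pbwVec]
@[simp] theorem pbwVec_two₇ (a b c d e f : ℕ) : pbwVec k a b c d e f 2 = 0 := by simp [pbwVec]

/-- Right multiplication by `x₁`. -/
noncomputable def mulX1 : Module.End k (PBWIndex →₀ k) := pbwLift (mulX1Fun q)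
/-- Right multiplication by `x₂`. -/
noncomputable def mulX2 : Module.End k (PBWIndex →₀ k) := pbwLift (mulX2Fun q)
/-- Right multiplication by `x₃`. -/
noncomputable def mulX3 : Module.End k (PBWIndex →₀ k) :=
  pbwLift fun m₁ m₂ m₃ m₄ m₅ m₆ m₇ => pbwVec k m₁ m₂ m₃ m₄ m₅ m₆ (m₇ + 1)
/-- Right multiplication by `x₁₃`. -/
noncomputable def mulX13 : Module.End k (PBWIndex →₀ k) :=
  pbwLift fun m₁ m₂ m₃ m₄ m₅ m₆ m₇ => (-q⁻¹) ^ m₇ • pbwVec k m₁ m₂ m₃ m₄ m₅ (m₆ + 1) m₇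
/-- Right multiplication by `x₂₃`. -/
noncomputable def mulX23 : Module.End k (PBWIndex →₀ k) :=
  pbwLift fun m₁ m₂ m₃ m₄ m₅ m₆ m₇ => (-q⁻¹) ^ m₇ • mulX23Fun q m₁ m₂ m₃ m₄ m₅ m₆ m₇
/-- Right multiplication by `u`. -/
noncomputable def mulU : Module.End k (PBWIndex →₀ k) :=
  pbwLift fun m₁ m₂ m₃ m₄ m₅ m₆ m₇ =>
    (q⁻¹ ^ (2 * m₇) * q ^ (2 * m₅)) • pbwVec k m₁ m₂ m₃ (m₄ + 1) m₅ m₆ m₇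
/-- Formula for right multiplication by `x₂₁₃` on a PBW monomial. -/
noncomputable def mulX213Fun (m₁ m₂ m₃ m₄ m₅ m₆ m₇ : ℕ) : PBWIndex →₀ k :=
  ((-q⁻¹ ^ 2) ^ m₇ * q⁻¹ ^ m₆ * q ^ m₅ * q⁻¹ ^ (2 * m₄)) • pbwVec k m₁ m₂ (m₃ + 1) m₄ m₅ m₆ m₇
    + (m₇ : k) • (
      (q⁻¹ * q ^ (2 * m₅) * (1 - 2 * (m₆ : k))) • pbwVec k m₁ m₂ m₃ (m₄ + 1) m₅ m₆ (m₇ - 1)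
      + (2 * q⁻¹ * (m₅ : k) * q⁻¹ ^ (2 * m₄)) •
        pbwVec k m₁ m₂ (m₃ + 1) m₄ (m₅ - 1) (m₆ + 1) (m₇ - 1)
      - (2 * q⁻¹ * (-q) ^ m₅ * q ^ m₃) • pbwVec k m₁ (m₂ + 1) m₃ m₄ m₅ (m₆ + 1) (m₇ - 1))

/-- Right multiplication by `x₂₁₃`. -/
noncomputable def mulX213 : Module.End k (PBWIndex →₀ k) := pbwLift (mulX213Fun q)

/-- Right multiplication by `x₃₁`. -/
noncomputable def mulX31 : Module.End k (PBWIndex →₀ k) :=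
  mulX1 q * mulX3 + q⁻¹ • (mulX3 * mulX1 q)

theorem mulX2_pbwVec_000 (hq : q ≠ 0) (m₁ m₂ m₃ m₄ : ℕ) (h₁ : m₁ < 2) (h₃ : m₃ < 2) :
    mulX2 q (pbwVec k m₁ m₂ m₃ m₄ 0 0 0) =
      -(((m₄ : k) * q⁻¹ ^ (2 * m₄)) • pbwVec k m₁ m₂ (m₃ + 1) (m₄ - 1) 0 1 0)
      + (q⁻¹ ^ (2 * m₄) * q⁻¹ ^ m₃ * (-1) ^ m₂ * q⁻¹ ^ m₂) • pbwVec k (m₁ + 1) m₂ m₃ m₄ 0 0 0 := by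
  simp [mulX2, pbwLift_pbwVec, mulX2Fun, mulX23Fun, h₁, h₃]
  match_scalars <;> field_simp

theorem mulX2_pbwVec_001 (hq : q ≠ 0) (m₁ m₂ m₃ m₄ : ℕ) (h₁ : m₁ < 2) (h₃ : m₃ < 2) :
    mulX2 q (pbwVec k m₁ m₂ m₃ m₄ 0 0 1) =
      -((q⁻¹ * (m₄ : k) * q⁻¹ ^ (2 * m₄)) • pbwVec k m₁ m₂ (m₃ + 1) (m₄ - 1) 0 1 1)
      + (q⁻¹ * q⁻¹ ^ (2 * m₄) * q⁻¹ ^ m₃ * (-1) ^ m₂ * q⁻¹ ^ m₂) • pbwVec k (m₁ + 1) m₂ m₃ m₄ 0 0 1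
      - (q⁻¹ * ((m₄ : k) + (m₃ : k))) • pbwVec k m₁ m₂ m₃ m₄ 0 1 0
      - (q⁻¹ * q ^ m₃) • pbwVec k m₁ (m₂ + 1) m₃ m₄ 0 0 0 := by
  simp [mulX2, pbwLift_pbwVec, mulX2Fun, mulX23Fun, h₁, h₃]
  match_scalars <;> field_simp

theorem mulX2_pbwVec_010 (hq : q ≠ 0) (m₁ m₂ m₃ m₄ : ℕ) (h₁ : m₁ < 2) (h₃ : m₃ < 2) :
    mulX2 q (pbwVec k m₁ m₂ m₃ m₄ 0 1 0) =
      (q⁻¹ * q⁻¹ ^ (2 * m₄)) • pbwVec k m₁ m₂ (m₃ + 1) m₄ 0 0 0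
      - (q⁻¹ * q⁻¹ ^ (2 * m₄) * q⁻¹ ^ m₃ * (-1) ^ m₂ * q⁻¹ ^ m₂) •
        pbwVec k (m₁ + 1) m₂ m₃ m₄ 0 1 0 := by
  simp [mulX2, pbwLift_pbwVec, mulX2Fun, mulX23Fun, h₁, h₃]
  match_scalars <;> field_simp

theorem mulX2_pbwVec_011 (hq : q ≠ 0) (m₁ m₂ m₃ m₄ : ℕ) (h₁ : m₁ < 2) (h₃ : m₃ < 2) :
    mulX2 q (pbwVec k m₁ m₂ m₃ m₄ 0 1 1) =
      (q⁻¹ * q⁻¹ * q⁻¹ ^ (2 * m₄)) • pbwVec k m₁ m₂ (m₃ + 1) m₄ 0 0 1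
      - (q⁻¹ * q⁻¹ * q⁻¹ ^ (2 * m₄) * q⁻¹ ^ m₃ * (-1) ^ m₂ * q⁻¹ ^ m₂) •
        pbwVec k (m₁ + 1) m₂ m₃ m₄ 0 1 1
      - q⁻¹ • pbwVec k m₁ m₂ m₃ (m₄ + 1) 0 0 0
      + (q⁻¹ * q ^ m₃) • pbwVec k m₁ (m₂ + 1) m₃ m₄ 0 1 0 := by
  simp [mulX2, pbwLift_pbwVec, mulX2Fun, mulX23Fun, h₁, h₃]
  match_scalars <;> field_simp

theorem mulX2_pbwVec_100 (hq : q ≠ 0) (m₁ m₂ m₃ m₄ : ℕ) (h₁ : m₁ < 2) (h₃ : m₃ < 2) :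
    mulX2 q (pbwVec k m₁ m₂ m₃ m₄ 1 0 0) =
      -((q⁻¹ * (m₄ : k) * q⁻¹ ^ (2 * m₄)) • pbwVec k m₁ m₂ (m₃ + 1) (m₄ - 1) 1 1 0)
      - (q⁻¹ ^ (2 * m₄) * q⁻¹ ^ m₃ * (-1) ^ m₂ * q⁻¹ ^ m₂) • pbwVec k (m₁ + 1) m₂ m₃ m₄ 1 0 0 := by
  simp [mulX2, pbwLift_pbwVec, mulX2Fun, mulX23Fun, h₁, h₃]
  match_scalars <;> field_simp

theorem mulX2_pbwVec_101 (hq : q ≠ 0) (m₁ m₂ m₃ m₄ : ℕ) (h₁ : m₁ < 2) (h₃ : m₃ < 2) :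
    mulX2 q (pbwVec k m₁ m₂ m₃ m₄ 1 0 1) =
      -((q⁻¹ * q⁻¹ * (m₄ : k) * q⁻¹ ^ (2 * m₄)) • pbwVec k m₁ m₂ (m₃ + 1) (m₄ - 1) 1 1 1)
      - (q⁻¹ * q⁻¹ ^ (2 * m₄) * q⁻¹ ^ m₃ * (-1) ^ m₂ * q⁻¹ ^ m₂) • pbwVec k (m₁ + 1) m₂ m₃ m₄ 1 0 1
      + (q⁻¹ * q⁻¹ ^ (2 * m₄)) • pbwVec k m₁ m₂ (m₃ + 1) m₄ 0 0 0
      - (q⁻¹ * ((m₄ : k) + (m₃ : k))) • pbwVec k m₁ m₂ m₃ m₄ 1 1 0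
      + (q⁻¹ * (q * q ^ m₃)) • pbwVec k m₁ (m₂ + 1) m₃ m₄ 1 0 0 := by
  simp [mulX2, pbwLift_pbwVec, mulX2Fun, mulX23Fun, h₁, h₃]
  match_scalars <;> field_simp

theorem mulX2_pbwVec_110 (hq : q ≠ 0) (m₁ m₂ m₃ m₄ : ℕ) (h₁ : m₁ < 2) (h₃ : m₃ < 2) :
    mulX2 q (pbwVec k m₁ m₂ m₃ m₄ 1 1 0) =
      (q⁻¹ ^ (2 * m₄)) • pbwVec k m₁ m₂ (m₃ + 1) m₄ 1 0 0
      + (q⁻¹ * q⁻¹ ^ (2 * m₄) * q⁻¹ ^ m₃ * (-1) ^ m₂ * q⁻¹ ^ m₂) •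
        pbwVec k (m₁ + 1) m₂ m₃ m₄ 1 1 0 := by
  simp [mulX2, pbwLift_pbwVec, mulX2Fun, mulX23Fun, h₁, h₃]
  match_scalars <;> field_simp

theorem mulX2_pbwVec_111 (hq : q ≠ 0) (m₁ m₂ m₃ m₄ : ℕ) (h₁ : m₁ < 2) (h₃ : m₃ < 2) :
    mulX2 q (pbwVec k m₁ m₂ m₃ m₄ 1 1 1) =
      (q⁻¹ * q⁻¹ ^ (2 * m₄)) • pbwVec k m₁ m₂ (m₃ + 1) m₄ 1 0 1
      + (q⁻¹ * q⁻¹ * q⁻¹ ^ (2 * m₄) * q⁻¹ ^ m₃ * (-1) ^ m₂ * q⁻¹ ^ m₂) •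
        pbwVec k (m₁ + 1) m₂ m₃ m₄ 1 1 1
      - (q⁻¹ * q ^ 2) • pbwVec k m₁ m₂ m₃ (m₄ + 1) 1 0 0
      - (q⁻¹ * q⁻¹ ^ (2 * m₄)) • pbwVec k m₁ m₂ (m₃ + 1) m₄ 0 1 0
      - (q⁻¹ * (q * q ^ m₃)) • pbwVec k m₁ (m₂ + 1) m₃ m₄ 1 1 0 := by
  simp [mulX2, pbwLift_pbwVec, mulX2Fun, mulX23Fun, h₁, h₃]
  match_scalars <;> field_simp

theorem mulX1_pbwVec_00 (m₁ m₂ m₃ m₄ m₅ : ℕ) (h₁ : m₁ < 2) (h₃ : m₃ < 2) (h₅ : m₅ < 2) :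
    mulX1 q (pbwVec k m₁ m₂ m₃ m₄ m₅ 0 0) =
      pbwVec k m₁ m₂ m₃ m₄ (m₅ + 1) 0 0 := by
  simp [pbwLift_pbwVec, mulX1, mulX1Fun, h₁, h₃, h₅]

theorem mulX1_pbwVec_01 (m₁ m₂ m₃ m₄ m₅ : ℕ) (h₁ : m₁ < 2) (h₃ : m₃ < 2) (h₅ : m₅ < 2) :
    mulX1 q (pbwVec k m₁ m₂ m₃ m₄ m₅ 0 1) =
      (q⁻¹) • pbwVec k m₁ m₂ m₃ m₄ (m₅ + 1) 0 1
      - q⁻¹ • pbwVec k m₁ m₂ m₃ m₄ m₅ 1 0 := by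
  simp [pbwLift_pbwVec, mulX1, mulX1Fun, h₁, h₃, h₅]

theorem mulX1_pbwVec_10 (m₁ m₂ m₃ m₄ m₅ : ℕ) (h₁ : m₁ < 2) (h₃ : m₃ < 2) (h₅ : m₅ < 2) :
    mulX1 q (pbwVec k m₁ m₂ m₃ m₄ m₅ 1 0) =
      -((q⁻¹) • pbwVec k m₁ m₂ m₃ m₄ (m₅ + 1) 1 0) := by
  simp [pbwLift_pbwVec, mulX1, mulX1Fun, h₁, h₃, h₅]

theorem mulX1_pbwVec_11 (m₁ m₂ m₃ m₄ m₅ : ℕ) (h₁ : m₁ < 2) (h₃ : m₃ < 2) (h₅ : m₅ < 2) :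
    mulX1 q (pbwVec k m₁ m₂ m₃ m₄ m₅ 1 1) =
      -((q⁻¹ * q⁻¹) • pbwVec k m₁ m₂ m₃ m₄ (m₅ + 1) 1 1) := by
  simp [pbwLift_pbwVec, mulX1, mulX1Fun, h₁, h₃, h₅]

theorem mulX23_pbwVec_00 (m₁ m₂ m₃ m₄ m₇ : ℕ) (h₁ : m₁ < 2) (h₃ : m₃ < 2) (h₇ : m₇ < 2) :
    mulX23 q (pbwVec k m₁ m₂ m₃ m₄ 0 0 m₇) =
      (-q⁻¹) ^ m₇ • (((m₄ : k) + (m₃ : k)) • pbwVec k m₁ m₂ m₃ m₄ 0 1 m₇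
      + q ^ m₃ • pbwVec k m₁ (m₂ + 1) m₃ m₄ 0 0 m₇) := by
  simp [pbwLift_pbwVec, mulX23, mulX23Fun, h₁, h₃, h₇]

theorem mulX23_pbwVec_01 (hq : q ≠ 0) (m₁ m₂ m₃ m₄ m₇ : ℕ)
    (h₁ : m₁ < 2) (h₃ : m₃ < 2) (h₇ : m₇ < 2) :
    mulX23 q (pbwVec k m₁ m₂ m₃ m₄ 0 1 m₇) =
      (-q⁻¹) ^ m₇ • (pbwVec k m₁ m₂ m₃ (m₄ + 1) 0 0 m₇
      - q ^ m₃ • pbwVec k m₁ (m₂ + 1) m₃ m₄ 0 1 m₇) := by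
  simp [pbwLift_pbwVec, mulX23, mulX23Fun, h₁, h₃, h₇]
  match_scalars <;> field_simp

theorem mulX23_pbwVec_10 (hq : q ≠ 0) (m₁ m₂ m₃ m₄ m₇ : ℕ)
    (h₁ : m₁ < 2) (h₃ : m₃ < 2) (h₇ : m₇ < 2) :
    mulX23 q (pbwVec k m₁ m₂ m₃ m₄ 1 0 m₇) =
      (-q⁻¹) ^ m₇ • (-(q⁻¹ ^ (2 * m₄) • pbwVec k m₁ m₂ (m₃ + 1) m₄ 0 0 m₇)
      + ((m₄ : k) + (m₃ : k)) • pbwVec k m₁ m₂ m₃ m₄ 1 1 m₇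
      - (q * q ^ m₃) • pbwVec k m₁ (m₂ + 1) m₃ m₄ 1 0 m₇) := by
  simp [pbwLift_pbwVec, mulX23, mulX23Fun, h₁, h₃, h₇]
  match_scalars <;> field_simp

theorem mulX23_pbwVec_11 (m₁ m₂ m₃ m₄ m₇ : ℕ) (h₁ : m₁ < 2) (h₃ : m₃ < 2) (h₇ : m₇ < 2) :
    mulX23 q (pbwVec k m₁ m₂ m₃ m₄ 1 1 m₇) =
      (-q⁻¹) ^ m₇ • (q ^ 2 • pbwVec k m₁ m₂ m₃ (m₄ + 1) 1 0 m₇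
      + q⁻¹ ^ (2 * m₄) • pbwVec k m₁ m₂ (m₃ + 1) m₄ 0 1 m₇
      + (q * q ^ m₃) • pbwVec k m₁ (m₂ + 1) m₃ m₄ 1 1 m₇) := by
  simp [pbwLift_pbwVec, mulX23, mulX23Fun, h₁, h₃, h₇]

theorem mulX213_pbwVec_000 (m₁ m₂ m₃ m₄ : ℕ) (h₁ : m₁ < 2) (h₃ : m₃ < 2) :
    mulX213 q (pbwVec k m₁ m₂ m₃ m₄ 0 0 0) =
      (q⁻¹ ^ (2 * m₄)) • pbwVec k m₁ m₂ (m₃ + 1) m₄ 0 0 0 := by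
  simp [pbwLift_pbwVec, mulX213, mulX213Fun, h₁, h₃]

theorem mulX213_pbwVec_001 (hq : q ≠ 0) (m₁ m₂ m₃ m₄ : ℕ) (h₁ : m₁ < 2) (h₃ : m₃ < 2) :
    mulX213 q (pbwVec k m₁ m₂ m₃ m₄ 0 0 1) =
      -((q⁻¹ * q⁻¹ * q⁻¹ ^ (2 * m₄)) • pbwVec k m₁ m₂ (m₃ + 1) m₄ 0 0 1)
      + (q⁻¹) • pbwVec k m₁ m₂ m₃ (m₄ + 1) 0 0 0
      - (2 * q⁻¹ * q ^ m₃) • pbwVec k m₁ (m₂ + 1) m₃ m₄ 0 1 0 := by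
  simp [pbwLift_pbwVec, mulX213, mulX213Fun, h₁, h₃]
  match_scalars <;> field_simp

theorem mulX213_pbwVec_010 (m₁ m₂ m₃ m₄ : ℕ) (h₁ : m₁ < 2) (h₃ : m₃ < 2) :
    mulX213 q (pbwVec k m₁ m₂ m₃ m₄ 0 1 0) =
      (q⁻¹ * q⁻¹ ^ (2 * m₄)) • pbwVec k m₁ m₂ (m₃ + 1) m₄ 0 1 0 := by
  simp [pbwLift_pbwVec, mulX213, mulX213Fun, h₁, h₃]

theorem mulX213_pbwVec_011 (hq : q ≠ 0) (m₁ m₂ m₃ m₄ : ℕ) (h₁ : m₁ < 2) (h₃ : m₃ < 2) :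
    mulX213 q (pbwVec k m₁ m₂ m₃ m₄ 0 1 1) =
      -((q⁻¹ * q⁻¹ * q⁻¹ * q⁻¹ ^ (2 * m₄)) • pbwVec k m₁ m₂ (m₃ + 1) m₄ 0 1 1)
      - (q⁻¹) • pbwVec k m₁ m₂ m₃ (m₄ + 1) 0 1 0 := by
  simp [pbwLift_pbwVec, mulX213, mulX213Fun, h₁, h₃]
  match_scalars <;> field_simp <;> ring

theorem mulX213_pbwVec_100 (m₁ m₂ m₃ m₄ : ℕ) (h₁ : m₁ < 2) (h₃ : m₃ < 2) :
    mulX213 q (pbwVec k m₁ m₂ m₃ m₄ 1 0 0) =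
      (q * q⁻¹ ^ (2 * m₄)) • pbwVec k m₁ m₂ (m₃ + 1) m₄ 1 0 0 := by
  simp [pbwLift_pbwVec, mulX213, mulX213Fun, h₁, h₃]

theorem mulX213_pbwVec_101 (hq : q ≠ 0) (m₁ m₂ m₃ m₄ : ℕ) (h₁ : m₁ < 2) (h₃ : m₃ < 2) :
    mulX213 q (pbwVec k m₁ m₂ m₃ m₄ 1 0 1) =
      -((q⁻¹ * q⁻¹ * q * q⁻¹ ^ (2 * m₄)) • pbwVec k m₁ m₂ (m₃ + 1) m₄ 1 0 1)
      + (q⁻¹ * q ^ 2) • pbwVec k m₁ m₂ m₃ (m₄ + 1) 1 0 0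
      + (2 * q⁻¹ * q⁻¹ ^ (2 * m₄)) • pbwVec k m₁ m₂ (m₃ + 1) m₄ 0 1 0
      + (2 * q ^ m₃) • pbwVec k m₁ (m₂ + 1) m₃ m₄ 1 1 0 := by
  simp [pbwLift_pbwVec, mulX213, mulX213Fun, h₁, h₃]
  match_scalars <;> field_simp

theorem mulX213_pbwVec_110 (m₁ m₂ m₃ m₄ : ℕ) (h₁ : m₁ < 2) (h₃ : m₃ < 2) :
    mulX213 q (pbwVec k m₁ m₂ m₃ m₄ 1 1 0) =
      (q⁻¹ * q * q⁻¹ ^ (2 * m₄)) • pbwVec k m₁ m₂ (m₃ + 1) m₄ 1 1 0 := by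
  simp [pbwLift_pbwVec, mulX213, mulX213Fun, h₁, h₃]

theorem mulX213_pbwVec_111 (hq : q ≠ 0) (m₁ m₂ m₃ m₄ : ℕ) (h₁ : m₁ < 2) (h₃ : m₃ < 2) :
    mulX213 q (pbwVec k m₁ m₂ m₃ m₄ 1 1 1) =
      -((q⁻¹ * q⁻¹ * q⁻¹ * q * q⁻¹ ^ (2 * m₄)) • pbwVec k m₁ m₂ (m₃ + 1) m₄ 1 1 1)
      - (q⁻¹ * q ^ 2) • pbwVec k m₁ m₂ m₃ (m₄ + 1) 1 1 0 := by
  simp [pbwLift_pbwVec, mulX213, mulX213Fun, h₁, h₃]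
  match_scalars <;> field_simp <;> ring

set_option maxHeartbeats 4000000 in
theorem mulX13_eq (hq : q ≠ 0) : mulX3 * mulX1 q - q • (mulX1 q * mulX3) = mulX13 q := by
  refine end_ext_pbwVec fun m₁ m₂ m₃ m₄ m₅ m₆ m₇ h₁ h₃ h₅ h₆ h₇ => ?_
  interval_cases m₅ <;> interval_cases m₆ <;> interval_cases m₇ <;>
    simp only [Module.End.mul_apply, mulX3, mulX13, mulX1_pbwVec_00, mulX1_pbwVec_01,
      mulX1_pbwVec_10, mulX1_pbwVec_11, pbwLift_pbwVec, h₁, h₃, LinearMap.zero_apply,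
      LinearMap.add_apply,
      LinearMap.sub_apply, LinearMap.smul_apply, map_add, map_sub, map_smul, map_neg, map_zero,
      Nat.cast_zero, Nat.cast_one, Nat.cast_add, Nat.reduceAdd, Nat.add_sub_cancel, Nat.reduceMul,
      zero_lt_two,
      one_lt_two, pow_zero, pow_one, zero_mul, mul_zero, zero_smul, one_mul, mul_one, one_smul,
      smul_zero,
      add_zero, zero_add, sub_zero, zero_sub, neg_zero, pbwVec_two₁, pbwVec_two₃, pbwVec_two₅,
      pbwVec_two₆, pbwVec_two₇, inv_pow] <;>
    (try match_scalars) <;> (try field_simp) <;> (try ring)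

set_option maxHeartbeats 4000000 in
theorem mulX23_eq (hq : q ≠ 0) : mulX3 * mulX2 q - q • (mulX2 q * mulX3) = mulX23 q := by
  refine end_ext_pbwVec fun m₁ m₂ m₃ m₄ m₅ m₆ m₇ h₁ h₃ h₅ h₆ h₇ => ?_
  interval_cases m₁ <;> interval_cases m₃ <;> interval_cases m₅ <;> interval_cases m₆ <;>
    interval_cases m₇ <;>
    simp only [Module.End.mul_apply, mulX3, mulX2_pbwVec_000 q hq, mulX2_pbwVec_001 q hq,
      mulX2_pbwVec_010 q hq, mulX2_pbwVec_011 q hq, mulX2_pbwVec_100 q hq, mulX2_pbwVec_101 q hq,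
      mulX2_pbwVec_110 q hq, mulX2_pbwVec_111 q hq, mulX23_pbwVec_00 q, mulX23_pbwVec_01 q hq,
      mulX23_pbwVec_10 q hq, mulX23_pbwVec_11 q, pbwLift_pbwVec, LinearMap.zero_apply,
      LinearMap.add_apply,
      LinearMap.sub_apply, LinearMap.smul_apply, map_add, map_sub, map_smul, map_neg, map_zero,
      Nat.cast_zero, Nat.cast_one, Nat.cast_add, Nat.reduceAdd, Nat.add_sub_cancel, Nat.reduceMul,
      zero_lt_two,
      one_lt_two, pow_zero, pow_one, zero_mul, mul_zero, zero_smul, one_mul, mul_one, one_smul,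
      smul_zero,
      add_zero, zero_add, sub_zero, zero_sub, neg_zero, pbwVec_two₁, pbwVec_two₃, pbwVec_two₅,
      pbwVec_two₆, pbwVec_two₇, inv_pow] <;>
    (try match_scalars) <;> (try field_simp) <;> (try ring)

set_option maxHeartbeats 4000000 in
theorem mulX213_eq (hq : q ≠ 0) : mulX13 q * mulX2 q + q • (mulX2 q * mulX13 q) = mulX213 q := by
  refine end_ext_pbwVec fun m₁ m₂ m₃ m₄ m₅ m₆ m₇ h₁ h₃ h₅ h₆ h₇ => ?_
  interval_cases m₁ <;> interval_cases m₃ <;> interval_cases m₅ <;> interval_cases m₆ <;>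
    interval_cases m₇ <;>
    simp only [Module.End.mul_apply, mulX13, mulX2_pbwVec_000 q hq, mulX2_pbwVec_001 q hq,
      mulX2_pbwVec_010 q hq, mulX2_pbwVec_011 q hq, mulX2_pbwVec_100 q hq, mulX2_pbwVec_101 q hq,
      mulX2_pbwVec_110 q hq, mulX2_pbwVec_111 q hq, mulX213_pbwVec_000 q, mulX213_pbwVec_001 q hq,
      mulX213_pbwVec_010 q, mulX213_pbwVec_011 q hq, mulX213_pbwVec_100 q, mulX213_pbwVec_101 q hq,
      mulX213_pbwVec_110 q, mulX213_pbwVec_111 q hq, pbwLift_pbwVec, LinearMap.zero_apply,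
      LinearMap.add_apply,
      LinearMap.sub_apply, LinearMap.smul_apply, map_add, map_sub, map_smul, map_neg, map_zero,
      Nat.cast_zero, Nat.cast_one, Nat.cast_add, Nat.reduceAdd, Nat.add_sub_cancel, Nat.reduceMul,
      zero_lt_two,
      one_lt_two, pow_zero, pow_one, zero_mul, mul_zero, zero_smul, one_mul, mul_one, one_smul,
      smul_zero,
      add_zero, zero_add, sub_zero, zero_sub, neg_zero, pbwVec_two₁, pbwVec_two₃, pbwVec_two₅,
      pbwVec_two₆, pbwVec_two₇, inv_pow] <;>
    (try match_scalars) <;> (try field_simp) <;> (try ring)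

set_option maxHeartbeats 4000000 in
theorem mulU_eq (hq : q ≠ 0) : mulX13 q * mulX23 q + mulX23 q * mulX13 q = mulU q := by
  refine end_ext_pbwVec fun m₁ m₂ m₃ m₄ m₅ m₆ m₇ h₁ h₃ h₅ h₆ h₇ => ?_
  interval_cases m₃ <;> interval_cases m₅ <;> interval_cases m₆ <;> interval_cases m₇ <;>
    simp only [Module.End.mul_apply, mulX13, mulU, mulX23_pbwVec_00 q, mulX23_pbwVec_01 q hq,
      mulX23_pbwVec_10 q hq, mulX23_pbwVec_11 q, pbwLift_pbwVec, h₁, LinearMap.zero_apply,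
      LinearMap.add_apply,
      LinearMap.sub_apply, LinearMap.smul_apply, map_add, map_sub, map_smul, map_neg, map_zero,
      Nat.cast_zero, Nat.cast_one, Nat.cast_add, Nat.reduceAdd, Nat.add_sub_cancel, Nat.reduceMul,
      zero_lt_two,
      one_lt_two, pow_zero, pow_one, zero_mul, mul_zero, zero_smul, one_mul, mul_one, one_smul,
      smul_zero,
      add_zero, zero_add, sub_zero, zero_sub, neg_zero, pbwVec_two₁, pbwVec_two₃, pbwVec_two₅,
      pbwVec_two₆, pbwVec_two₇, inv_pow] <;>
    (try match_scalars) <;> (try field_simp) <;> (try ring)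

set_option maxHeartbeats 4000000 in
theorem mulX1_mul_mulX1 : mulX1 q * mulX1 q = 0 := by
  refine end_ext_pbwVec fun m₁ m₂ m₃ m₄ m₅ m₆ m₇ h₁ h₃ h₅ h₆ h₇ => ?_
  interval_cases m₅ <;> interval_cases m₆ <;> interval_cases m₇ <;>
    simp only [Module.End.mul_apply, mulX1_pbwVec_00, mulX1_pbwVec_01, mulX1_pbwVec_10,
      mulX1_pbwVec_11, h₁, h₃, LinearMap.zero_apply, LinearMap.add_apply,
      LinearMap.sub_apply, LinearMap.smul_apply, map_add, map_sub, map_smul, map_neg, map_zero,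
      Nat.cast_zero, Nat.cast_one, Nat.cast_add, Nat.reduceAdd, Nat.add_sub_cancel, Nat.reduceMul,
      zero_lt_two,
      one_lt_two, pow_zero, pow_one, zero_mul, mul_zero, zero_smul, one_mul, mul_one, one_smul,
      smul_zero,
      add_zero, zero_add, sub_zero, zero_sub, neg_zero, pbwVec_two₁, pbwVec_two₃, pbwVec_two₅,
      pbwVec_two₆, pbwVec_two₇, inv_pow] <;>
    (try match_scalars) <;> (try field_simp) <;> (try ring)

set_option maxHeartbeats 4000000 in
theorem mulX2_mul_mulX2 (hq : q ≠ 0) : mulX2 q * mulX2 q = 0 := by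
  refine end_ext_pbwVec fun m₁ m₂ m₃ m₄ m₅ m₆ m₇ h₁ h₃ h₅ h₆ h₇ => ?_
  interval_cases m₁ <;> interval_cases m₃ <;> interval_cases m₅ <;> interval_cases m₆ <;>
    interval_cases m₇ <;> rcases m₄ with - | m₄ <;>
    simp only [Module.End.mul_apply, mulX2_pbwVec_000 q hq, mulX2_pbwVec_001 q hq,
      mulX2_pbwVec_010 q hq, mulX2_pbwVec_011 q hq, mulX2_pbwVec_100 q hq, mulX2_pbwVec_101 q hq,
      mulX2_pbwVec_110 q hq, mulX2_pbwVec_111 q hq, LinearMap.zero_apply, LinearMap.add_apply,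
      LinearMap.sub_apply, LinearMap.smul_apply, map_add, map_sub, map_smul, map_neg, map_zero,
      Nat.cast_zero, Nat.cast_one, Nat.cast_add, Nat.reduceAdd, Nat.add_sub_cancel, Nat.reduceMul,
      zero_lt_two,
      one_lt_two, pow_zero, pow_one, zero_mul, mul_zero, zero_smul, one_mul, mul_one, one_smul,
      smul_zero,
      add_zero, zero_add, sub_zero, zero_sub, neg_zero, pbwVec_two₁, pbwVec_two₃, pbwVec_two₅,
      pbwVec_two₆, pbwVec_two₇, inv_pow] <;>
    (try match_scalars) <;> (try field_simp) <;> (try ring)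

set_option maxHeartbeats 4000000 in
theorem mulX2_mul_mulX1 (hq : q ≠ 0) : mulX2 q * mulX1 q + mulX1 q * mulX2 q = 0 := by
  refine end_ext_pbwVec fun m₁ m₂ m₃ m₄ m₅ m₆ m₇ h₁ h₃ h₅ h₆ h₇ => ?_
  interval_cases m₁ <;> interval_cases m₃ <;> interval_cases m₅ <;> interval_cases m₆ <;>
    interval_cases m₇ <;>
    simp only [Module.End.mul_apply, mulX2_pbwVec_000 q hq, mulX2_pbwVec_001 q hq,
      mulX2_pbwVec_010 q hq, mulX2_pbwVec_011 q hq, mulX2_pbwVec_100 q hq, mulX2_pbwVec_101 q hq,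
      mulX2_pbwVec_110 q hq, mulX2_pbwVec_111 q hq, mulX1_pbwVec_00, mulX1_pbwVec_01,
      mulX1_pbwVec_10, mulX1_pbwVec_11, LinearMap.zero_apply, LinearMap.add_apply,
      LinearMap.sub_apply, LinearMap.smul_apply, map_add, map_sub, map_smul, map_neg, map_zero,
      Nat.cast_zero, Nat.cast_one, Nat.cast_add, Nat.reduceAdd, Nat.add_sub_cancel, Nat.reduceMul,
      zero_lt_two,
      one_lt_two, pow_zero, pow_one, zero_mul, mul_zero, zero_smul, one_mul, mul_one, one_smul,
      smul_zero,
      add_zero, zero_add, sub_zero, zero_sub, neg_zero, pbwVec_two₁, pbwVec_two₃, pbwVec_two₅,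
      pbwVec_two₆, pbwVec_two₇, inv_pow] <;>
    (try match_scalars) <;> (try field_simp) <;> (try ring)

set_option maxHeartbeats 4000000 in
theorem mulX3_mul_mulX3 : mulX3 * mulX3 = (0 : Module.End k (PBWIndex →₀ k)) := by
  refine end_ext_pbwVec fun m₁ m₂ m₃ m₄ m₅ m₆ m₇ h₁ h₃ h₅ h₆ h₇ => ?_
  interval_cases m₇ <;>
    simp only [Module.End.mul_apply, mulX3, pbwLift_pbwVec, h₁, h₃, h₅, h₆, LinearMap.zero_apply,
      LinearMap.add_apply,
      LinearMap.sub_apply, LinearMap.smul_apply, map_add, map_sub, map_smul, map_neg, map_zero,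
      Nat.cast_zero, Nat.cast_one, Nat.cast_add, Nat.reduceAdd, Nat.add_sub_cancel, Nat.reduceMul,
      zero_lt_two,
      one_lt_two, pow_zero, pow_one, zero_mul, mul_zero, zero_smul, one_mul, mul_one, one_smul,
      smul_zero,
      add_zero, zero_add, sub_zero, zero_sub, neg_zero, pbwVec_two₁, pbwVec_two₃, pbwVec_two₅,
      pbwVec_two₆, pbwVec_two₇, inv_pow]

set_option maxHeartbeats 4000000 in
theorem mulX31_mul_mulX31 (hq : q ≠ 0) : mulX31 q * mulX31 q = 0 := by
  refine end_ext_pbwVec fun m₁ m₂ m₃ m₄ m₅ m₆ m₇ h₁ h₃ h₅ h₆ h₇ => ?_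
  interval_cases m₅ <;> interval_cases m₆ <;> interval_cases m₇ <;>
    simp only [Module.End.mul_apply, mulX31, mulX3, mulX1_pbwVec_00, mulX1_pbwVec_01,
      mulX1_pbwVec_10, mulX1_pbwVec_11, pbwLift_pbwVec, h₁, h₃, LinearMap.zero_apply,
      LinearMap.add_apply,
      LinearMap.sub_apply, LinearMap.smul_apply, map_add, map_sub, map_smul, map_neg, map_zero,
      Nat.cast_zero, Nat.cast_one, Nat.cast_add, Nat.reduceAdd, Nat.add_sub_cancel, Nat.reduceMul,
      zero_lt_two,
      one_lt_two, pow_zero, pow_one, zero_mul, mul_zero, zero_smul, one_mul, mul_one, one_smul,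
      smul_zero,
      add_zero, zero_add, sub_zero, zero_sub, neg_zero, pbwVec_two₁, pbwVec_two₃, pbwVec_two₅,
      pbwVec_two₆, pbwVec_two₇, inv_pow] <;>
    (try match_scalars) <;> (try field_simp) <;> (try ring)

set_option maxHeartbeats 4000000 in
theorem mulX213_mul_mulX213 (hq : q ≠ 0) : mulX213 q * mulX213 q = 0 := by
  refine end_ext_pbwVec fun m₁ m₂ m₃ m₄ m₅ m₆ m₇ h₁ h₃ h₅ h₆ h₇ => ?_
  interval_cases m₃ <;> interval_cases m₅ <;> interval_cases m₆ <;> interval_cases m₇ <;>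
    simp only [Module.End.mul_apply, mulX213_pbwVec_000 q, mulX213_pbwVec_001 q hq,
      mulX213_pbwVec_010 q, mulX213_pbwVec_011 q hq, mulX213_pbwVec_100 q, mulX213_pbwVec_101 q hq,
      mulX213_pbwVec_110 q, mulX213_pbwVec_111 q hq, h₁, LinearMap.zero_apply, LinearMap.add_apply,
      LinearMap.sub_apply, LinearMap.smul_apply, map_add, map_sub, map_smul, map_neg, map_zero,
      Nat.cast_zero, Nat.cast_one, Nat.cast_add, Nat.reduceAdd, Nat.add_sub_cancel, Nat.reduceMul,
      zero_lt_two,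
      one_lt_two, pow_zero, pow_one, zero_mul, mul_zero, zero_smul, one_mul, mul_one, one_smul,
      smul_zero,
      add_zero, zero_add, sub_zero, zero_sub, neg_zero, pbwVec_two₁, pbwVec_two₃, pbwVec_two₅,
      pbwVec_two₆, pbwVec_two₇, inv_pow] <;>
    (try match_scalars) <;> (try field_simp) <;> (try ring)

set_option maxHeartbeats 4000000 in
theorem mulU_mul_mulX2 (hq : q ≠ 0) : mulU q * mulX2 q - q ^ 2 • (mulX2 q * mulU q) - q •
    (mulX213 q * mulX13 q) = 0 := by
  refine end_ext_pbwVec fun m₁ m₂ m₃ m₄ m₅ m₆ m₇ h₁ h₃ h₅ h₆ h₇ => ?_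
  interval_cases m₁ <;> interval_cases m₃ <;> interval_cases m₅ <;> interval_cases m₆ <;>
    interval_cases m₇ <;> rcases m₄ with - | m₄ <;>
    simp only [Module.End.mul_apply, mulX213_pbwVec_000 q, mulX213_pbwVec_001 q hq,
      mulX213_pbwVec_010 q, mulX213_pbwVec_011 q hq, mulX213_pbwVec_100 q, mulX213_pbwVec_101 q hq,
      mulX213_pbwVec_110 q, mulX213_pbwVec_111 q hq, mulX2_pbwVec_000 q hq, mulX2_pbwVec_001 q hq,
      mulX2_pbwVec_010 q hq, mulX2_pbwVec_011 q hq, mulX2_pbwVec_100 q hq, mulX2_pbwVec_101 q hq,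
      mulX2_pbwVec_110 q hq, mulX2_pbwVec_111 q hq, mulX13, mulU, pbwLift_pbwVec,
      LinearMap.zero_apply, LinearMap.add_apply,
      LinearMap.sub_apply, LinearMap.smul_apply, map_add, map_sub, map_smul, map_neg, map_zero,
      Nat.cast_zero, Nat.cast_one, Nat.cast_add, Nat.reduceAdd, Nat.add_sub_cancel, Nat.reduceMul,
      zero_lt_two,
      one_lt_two, pow_zero, pow_one, zero_mul, mul_zero, zero_smul, one_mul, mul_one, one_smul,
      smul_zero,
      add_zero, zero_add, sub_zero, zero_sub, neg_zero, pbwVec_two₁, pbwVec_two₃, pbwVec_two₅,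
      pbwVec_two₆, pbwVec_two₇, inv_pow] <;>
    (try match_scalars) <;> (try field_simp) <;> (try ring)

end RightRegular

section Representation

variable {k : Type*} [Field k] {q : k}

/-- The right regular representation, as an algebra map on the free algebra. -/
noncomputable def rightRegularFree (q : k) :
    FreeAlgebra k (Fin 3) →ₐ[k] (Module.End k (PBWIndex →₀ k))ᵐᵒᵖ :=
  FreeAlgebra.lift k
    ![MulOpposite.op (mulX1 q), MulOpposite.op (mulX2 q), MulOpposite.op mulX3]

theorem rightRegularFree_X_zero : rightRegularFree q (X k 0) = MulOpposite.op (mulX1 q) := by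
  simp [rightRegularFree, X]

theorem rightRegularFree_X_one : rightRegularFree q (X k 1) = MulOpposite.op (mulX2 q) := by
  simp [rightRegularFree, X]

theorem rightRegularFree_X_two : rightRegularFree q (X k 2) = MulOpposite.op mulX3 := by
  simp [rightRegularFree, X]

theorem rightRegularFree_x13 (hq : q ≠ 0) :
    rightRegularFree q (x13 k q) = MulOpposite.op (mulX13 q) := by
  simp only [x13, map_sub, map_mul, map_smul, rightRegularFree_X_zero, rightRegularFree_X_two,
    ← MulOpposite.op_mul, ← MulOpposite.op_smul, ← MulOpposite.op_sub, mulX13_eq q hq]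

theorem rightRegularFree_x23 (hq : q ≠ 0) :
    rightRegularFree q (x23 k q) = MulOpposite.op (mulX23 q) := by
  simp only [x23, map_sub, map_mul, map_smul, rightRegularFree_X_one, rightRegularFree_X_two,
    ← MulOpposite.op_mul, ← MulOpposite.op_smul, ← MulOpposite.op_sub, mulX23_eq q hq]

theorem rightRegularFree_x31 :
    rightRegularFree q (x31 k q) = MulOpposite.op (mulX31 q) := by
  simp only [x31, map_add, map_mul, map_smul, rightRegularFree_X_zero, rightRegularFree_X_two,
    ← MulOpposite.op_mul, ← MulOpposite.op_smul, ← MulOpposite.op_add, mulX31]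

theorem rightRegularFree_x213 (hq : q ≠ 0) :
    rightRegularFree q (x213 k q) = MulOpposite.op (mulX213 q) := by
  simp only [x213, map_add, map_mul, map_smul, rightRegularFree_X_one, rightRegularFree_x13 hq,
    ← MulOpposite.op_mul, ← MulOpposite.op_smul, ← MulOpposite.op_add, mulX213_eq q hq]

theorem rightRegularFree_uu (hq : q ≠ 0) :
    rightRegularFree q (uu k q) = MulOpposite.op (mulU q) := by
  simp only [uu, map_add, map_mul, rightRegularFree_x23 hq, rightRegularFree_x13 hq,
    ← MulOpposite.op_mul, ← MulOpposite.op_add, mulU_eq q hq]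

theorem rightRegularFree_rel (hq : q ≠ 0) ⦃a b : FreeAlgebra k (Fin 3)⦄ (h : enyRel k q a b) :
    rightRegularFree q a = rightRegularFree q b := by
  obtain ⟨rfl, rfl | rfl | rfl | rfl | rfl | rfl | rfl⟩ := h <;>
  simp only [map_add, map_sub, map_mul, map_smul, map_zero, rightRegularFree_X_zero,
    rightRegularFree_X_one, rightRegularFree_X_two, rightRegularFree_x31,
    rightRegularFree_x13 hq, rightRegularFree_x213 hq, rightRegularFree_uu hq,
    ← MulOpposite.op_mul, ← MulOpposite.op_add, ← MulOpposite.op_smul, ← MulOpposite.op_sub,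
    mulX1_mul_mulX1, mulX2_mul_mulX2 q hq, mulX2_mul_mulX1 q hq, mulX3_mul_mulX3,
    mulX31_mul_mulX31 q hq, mulX213_mul_mulX213 q hq, mulU_mul_mulX2 q hq, MulOpposite.op_zero]

/-- The right regular representation of the Endymion algebra on the span of the PBW monomials. -/
noncomputable def rightRegular (hq : q ≠ 0) :
    RingQuot (enyRel k q) →ₐ[k] (Module.End k (PBWIndex →₀ k))ᵐᵒᵖ :=
  RingQuot.liftAlgHom k ⟨rightRegularFree q, rightRegularFree_rel hq⟩

theorem rightRegular_mkAlgHom (hq : q ≠ 0) (a : FreeAlgebra k (Fin 3)) :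
    rightRegular hq (RingQuot.mkAlgHom k (enyRel k q) a) = rightRegularFree q a := by
  simp [rightRegular]

theorem mulX2_pow_apply {m : ℕ} (hm : m < 2) :
    (mulX2 q ^ m) (pbwVec k 0 0 0 0 0 0 0) = pbwVec k m 0 0 0 0 0 0 := by
  interval_cases m <;> simp [mulX2, pbwLift_pbwVec, mulX2Fun, mulX23Fun]

theorem mulX23_pow_apply {m₁ : ℕ} (h₁ : m₁ < 2) (m : ℕ) :
    (mulX23 q ^ m) (pbwVec k m₁ 0 0 0 0 0 0) = pbwVec k m₁ m 0 0 0 0 0 := by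
  induction m with
  | zero => simp
  | succ m ih =>
    rw [pow_succ', Module.End.mul_apply, ih]
    simp [mulX23, pbwLift_pbwVec, mulX23Fun, h₁]

theorem mulX213_pow_apply {m₁ m₃ : ℕ} (h₁ : m₁ < 2) (m₂ : ℕ) (h₃ : m₃ < 2) :
    (mulX213 q ^ m₃) (pbwVec k m₁ m₂ 0 0 0 0 0) = pbwVec k m₁ m₂ m₃ 0 0 0 0 := by
  interval_cases m₃ <;> simp [mulX213, pbwLift_pbwVec, mulX213Fun, h₁]

theorem mulU_pow_apply {m₁ m₃ : ℕ} (h₁ : m₁ < 2) (m₂ : ℕ) (h₃ : m₃ < 2) (m : ℕ) :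
    (mulU q ^ m) (pbwVec k m₁ m₂ m₃ 0 0 0 0) = pbwVec k m₁ m₂ m₃ m 0 0 0 := by
  induction m with
  | zero => simp
  | succ m ih =>
    rw [pow_succ', Module.End.mul_apply, ih]
    simp [mulU, pbwLift_pbwVec, h₁, h₃]

theorem mulX1_pow_apply {m₁ m₃ m₅ : ℕ} (h₁ : m₁ < 2) (m₂ : ℕ) (h₃ : m₃ < 2) (m₄ : ℕ)
    (h₅ : m₅ < 2) :
    (mulX1 q ^ m₅) (pbwVec k m₁ m₂ m₃ m₄ 0 0 0) = pbwVec k m₁ m₂ m₃ m₄ m₅ 0 0 := by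
  interval_cases m₅ <;> simp [mulX1, pbwLift_pbwVec, mulX1Fun, h₁, h₃]

theorem mulX13_pow_apply {m₁ m₃ m₅ m₆ : ℕ} (h₁ : m₁ < 2) (m₂ : ℕ) (h₃ : m₃ < 2) (m₄ : ℕ)
    (h₅ : m₅ < 2) (h₆ : m₆ < 2) :
    (mulX13 q ^ m₆) (pbwVec k m₁ m₂ m₃ m₄ m₅ 0 0) = pbwVec k m₁ m₂ m₃ m₄ m₅ m₆ 0 := by
  interval_cases m₆ <;> simp [mulX13, pbwLift_pbwVec, h₁, h₃, h₅]

theorem mulX3_pow_apply {m₁ m₃ m₅ m₆ m₇ : ℕ} (h₁ : m₁ < 2) (m₂ : ℕ) (h₃ : m₃ < 2) (m₄ : ℕ)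
    (h₅ : m₅ < 2) (h₆ : m₆ < 2) (h₇ : m₇ < 2) :
    (mulX3 ^ m₇) (pbwVec k m₁ m₂ m₃ m₄ m₅ m₆ 0) = pbwVec k m₁ m₂ m₃ m₄ m₅ m₆ m₇ := by
  interval_cases m₇ <;> simp [mulX3, pbwLift_pbwVec, h₁, h₃, h₅, h₆]

/-- The coordinates of an element of the Endymion algebra in the PBW monomials. -/
noncomputable def pbwCoord (hq : q ≠ 0) : RingQuot (enyRel k q) →ₗ[k] PBWIndex →₀ k where
  toFun a := (rightRegular hq a).unop (pbwVec k 0 0 0 0 0 0 0)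
  map_add' _ _ := by simp
  map_smul' _ _ := by simp

theorem pbwCoord_bas (hq : q ≠ 0) (p : PBWIndex) :
    pbwCoord hq (bas k q p) = Finsupp.single p 1 := by
  simp only [pbwCoord, LinearMap.coe_mk, AddHom.coe_mk, bas, rightRegular_mkAlgHom, map_mul,
    map_pow, rightRegularFree_X_zero, rightRegularFree_X_one, rightRegularFree_X_two,
    rightRegularFree_x13 hq, rightRegularFree_x23 hq, rightRegularFree_x213 hq,
    rightRegularFree_uu hq, ← MulOpposite.op_mul, ← MulOpposite.op_pow, MulOpposite.unop_op,
    Module.End.mul_apply, mulX2_pow_apply p.1.2, mulX23_pow_apply p.1.2,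
    mulX213_pow_apply p.1.2 _ p.2.2.1.2, mulU_pow_apply p.1.2 _ p.2.2.1.2,
    mulX1_pow_apply p.1.2 _ p.2.2.1.2 _ p.2.2.2.2.1.2,
    mulX13_pow_apply p.1.2 _ p.2.2.1.2 _ p.2.2.2.2.1.2 p.2.2.2.2.2.1.2,
    mulX3_pow_apply p.1.2 _ p.2.2.1.2 _ p.2.2.2.2.1.2 p.2.2.2.2.2.1.2 p.2.2.2.2.2.2.2,
    single_eq_pbwVec]

theorem linearIndependent_bas (hq : q ≠ 0) : LinearIndependent k (bas k q) := by
  refine LinearIndependent.of_comp (pbwCoord hq) ?_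
  have : pbwCoord hq ∘ bas k q = fun p => Finsupp.single p (1 : k) :=
    funext (pbwCoord_bas hq)
  rw [this]
  exact Finsupp.linearIndependent_single_one k PBWIndex

end Representation

/-- A triple `x₁, x₂, x₃` in a `k`-algebra subject to the defining relations of the Endymion
algebra, together with the derived elements. -/
structure IsEnyTuple {k A : Type*} [Field k] [Ring A] [Algebra k A] (q : k)
    (x₁ x₂ x₃ b y c u : A) : Prop where
  b_eq : b = x₁ * x₃ - q • (x₃ * x₁)
  y_eq : y = x₂ * x₃ - q • (x₃ * x₂)
  c_eq : c = x₂ * b + q • (b * x₂)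
  u_eq : u = y * b + b * y
  x₁_sq : x₁ * x₁ = 0
  x₂_sq : x₂ * x₂ = 0
  x₁_x₂ : x₁ * x₂ + x₂ * x₁ = 0
  x₃_sq : x₃ * x₃ = 0
  x₃₁_sq : (x₃ * x₁ + q⁻¹ • (x₁ * x₃)) * (x₃ * x₁ + q⁻¹ • (x₁ * x₃)) = 0
  c_sq : c * c = 0
  x₂_u : x₂ * u - q ^ 2 • (u * x₂) - q • (b * c) = 0

theorem mul_mul_of_mul_eq {A : Type*} [Semigroup A] {x y z : A} (h : x * y = z) (w : A) :
    x * (y * w) = z * w := by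
  rw [← mul_assoc, h]

namespace IsEnyTuple

variable {k A : Type*} [Field k] [Ring A] [Algebra k A] {q : k} {x₁ x₂ x₃ b y c u : A}

theorem mul_x₁_x₂ (h : IsEnyTuple q x₁ x₂ x₃ b y c u) : x₁ * x₂ = -(x₂ * x₁) :=
  eq_neg_of_add_eq_zero_left h.x₁_x₂

theorem mul_b_x₁ (h : IsEnyTuple q x₁ x₂ x₃ b y c u) (hq : q ≠ 0) :
    b * x₁ = -(q⁻¹ • (x₁ * b)) := by
  simp only [h.b_eq, sub_mul, mul_sub, smul_mul_assoc, mul_smul_comm, mul_assoc, h.x₁_sq,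
    mul_mul_of_mul_eq h.x₁_sq, mul_zero, zero_mul, smul_zero]
  match_scalars <;> field_simp

theorem mul_x₃_b (h : IsEnyTuple q x₁ x₂ x₃ b y c u) (hq : q ≠ 0) :
    x₃ * b = -(q⁻¹ • (b * x₃)) := by
  simp only [h.b_eq, sub_mul, mul_sub, smul_mul_assoc, mul_smul_comm, mul_assoc, h.x₃_sq,
    mul_mul_of_mul_eq h.x₃_sq, mul_zero, zero_mul, smul_zero]
  match_scalars <;> field_simp

theorem mul_b_b (h : IsEnyTuple q x₁ x₂ x₃ b y c u) (hq : q ≠ 0) : b * b = 0 := by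
  have e := h.x₃₁_sq
  have : b * b = (q ^ 2) • ((x₃ * x₁ + q⁻¹ • (x₁ * x₃)) * (x₃ * x₁ + q⁻¹ • (x₁ * x₃))) := by
    simp only [h.b_eq, sub_mul, mul_sub, add_mul, mul_add, smul_mul_assoc, mul_smul_comm,
      mul_assoc, h.x₁_sq, h.x₃_sq, mul_mul_of_mul_eq h.x₁_sq, mul_mul_of_mul_eq h.x₃_sq,
      mul_zero, zero_mul, smul_zero]
    match_scalars <;> field_simp
  rw [this, e, smul_zero]

theorem mul_x₃_y (h : IsEnyTuple q x₁ x₂ x₃ b y c u) (hq : q ≠ 0) :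
    x₃ * y = -(q⁻¹ • (y * x₃)) := by
  simp only [h.y_eq, sub_mul, mul_sub, smul_mul_assoc, mul_smul_comm, mul_assoc, h.x₃_sq,
    mul_mul_of_mul_eq h.x₃_sq, mul_zero, zero_mul, smul_zero]
  match_scalars <;> field_simp

theorem mul_y_x₂ (h : IsEnyTuple q x₁ x₂ x₃ b y c u) (hq : q ≠ 0) :
    y * x₂ = -(q⁻¹ • (x₂ * y)) := by
  simp only [h.y_eq, sub_mul, mul_sub, smul_mul_assoc, mul_smul_comm, mul_assoc, h.x₂_sq,
    mul_mul_of_mul_eq h.x₂_sq, mul_zero, zero_mul, smul_zero]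
  match_scalars <;> field_simp

theorem mul_x₃_x₁ (h : IsEnyTuple q x₁ x₂ x₃ b y c u) (hq : q ≠ 0) :
    x₃ * x₁ = q⁻¹ • (x₁ * x₃) - q⁻¹ • b := by
  rw [h.b_eq]; match_scalars <;> field_simp; ring

theorem mul_x₃_x₂ (h : IsEnyTuple q x₁ x₂ x₃ b y c u) (hq : q ≠ 0) :
    x₃ * x₂ = q⁻¹ • (x₂ * x₃) - q⁻¹ • y := by
  rw [h.y_eq]; match_scalars <;> field_simp; ring

theorem mul_b_x₂ (h : IsEnyTuple q x₁ x₂ x₃ b y c u) (hq : q ≠ 0) :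
    b * x₂ = q⁻¹ • c - q⁻¹ • (x₂ * b) := by
  rw [h.c_eq]; match_scalars <;> field_simp; ring

theorem mul_b_y (h : IsEnyTuple q x₁ x₂ x₃ b y c u) : b * y = u - y * b := by
  rw [h.u_eq]; abel

theorem mul_c_x₂ (h : IsEnyTuple q x₁ x₂ x₃ b y c u) (hq : q ≠ 0) :
    c * x₂ = q⁻¹ • (x₂ * c) := by
  simp only [h.c_eq, add_mul, mul_add, smul_mul_assoc, mul_smul_comm, mul_assoc, h.x₂_sq,
    mul_mul_of_mul_eq h.x₂_sq, mul_zero, zero_mul, smul_zero]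
  match_scalars <;> field_simp

theorem mul_x₁_c (h : IsEnyTuple q x₁ x₂ x₃ b y c u) (hq : q ≠ 0) :
    x₁ * c = q • (c * x₁) := by
  have e : x₁ * (b * x₂) = q • (b * (x₂ * x₁)) := by
    have : b * (x₂ * x₁) = -(b * x₁ * x₂) := by
      rw [mul_assoc, h.mul_x₁_x₂, mul_neg, neg_neg]
    rw [this, h.mul_b_x₁ hq]
    simp only [neg_mul, smul_mul_assoc, mul_assoc, neg_neg]
    match_scalars <;> field_simp
  simp only [h.c_eq, add_mul, mul_add, smul_mul_assoc, mul_smul_comm, mul_assoc, e,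
    mul_mul_of_mul_eq h.mul_x₁_x₂, h.mul_b_x₁ hq, mul_neg, neg_mul]
  match_scalars <;> field_simp

theorem mul_x₁_y (h : IsEnyTuple q x₁ x₂ x₃ b y c u) :
    x₁ * y = -c - q • (y * x₁) := by
  simp only [h.c_eq, h.y_eq, h.b_eq, sub_mul, mul_sub, add_mul, mul_add, smul_mul_assoc,
    mul_smul_comm, mul_assoc, h.mul_x₁_x₂, mul_mul_of_mul_eq h.mul_x₁_x₂, mul_neg, neg_mul]
  module

theorem mul_x₃_c (h : IsEnyTuple q x₁ x₂ x₃ b y c u) (hq : q ≠ 0) :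
    x₃ * c = -((2 * q⁻¹) • (y * b)) + q⁻¹ • u - (q⁻¹ ^ 2) • (c * x₃) := by
  simp only [h.c_eq, h.u_eq, sub_mul, mul_sub, add_mul, mul_add, smul_mul_assoc,
    mul_smul_comm, mul_assoc, mul_neg, neg_mul, h.mul_x₃_x₂ hq, mul_mul_of_mul_eq (h.mul_x₃_x₂ hq),
    h.mul_x₃_b hq, mul_mul_of_mul_eq (h.mul_x₃_b hq)]
  match_scalars <;> field_simp <;> ring

theorem mul_b_c (h : IsEnyTuple q x₁ x₂ x₃ b y c u) (hq : q ≠ 0) :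
    b * c = q⁻¹ • (c * b) := by
  simp only [h.c_eq, add_mul, mul_add, smul_mul_assoc, mul_smul_comm, mul_assoc, h.mul_b_b hq,
    mul_mul_of_mul_eq (h.mul_b_b hq), mul_zero, zero_mul, smul_zero]
  match_scalars <;> field_simp

theorem mul_b_u (h : IsEnyTuple q x₁ x₂ x₃ b y c u) (hq : q ≠ 0) : b * u = u * b := by
  simp only [h.u_eq, add_mul, mul_add, mul_assoc, h.mul_b_b hq,
    mul_mul_of_mul_eq (h.mul_b_b hq), mul_zero, zero_mul]
  abel

theorem mul_x₁_b (h : IsEnyTuple q x₁ x₂ x₃ b y c u) (hq : q ≠ 0) :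
    x₁ * b = -(q • (b * x₁)) := by
  rw [h.mul_b_x₁ hq]; match_scalars <;> field_simp

theorem mul_x₁_u (h : IsEnyTuple q x₁ x₂ x₃ b y c u) (hq : q ≠ 0) :
    x₁ * u = (q ^ 2) • (u * x₁) := by
  simp only [h.u_eq, sub_mul, mul_sub, add_mul, mul_add, smul_mul_assoc,
    mul_smul_comm, mul_assoc, mul_neg, neg_mul, h.mul_x₁_y, mul_mul_of_mul_eq h.mul_x₁_y,
    h.mul_x₁_b hq, mul_mul_of_mul_eq (h.mul_x₁_b hq), h.mul_b_c hq]
  match_scalars <;> field_simp <;> ring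

theorem mul_x₃_u (h : IsEnyTuple q x₁ x₂ x₃ b y c u) (hq : q ≠ 0) :
    x₃ * u = (q⁻¹ ^ 2) • (u * x₃) := by
  simp only [h.u_eq, sub_mul, mul_sub, add_mul, mul_add, smul_mul_assoc,
    mul_smul_comm, mul_assoc, mul_neg, neg_mul, h.mul_x₃_y hq, mul_mul_of_mul_eq (h.mul_x₃_y hq),
    h.mul_x₃_b hq, mul_mul_of_mul_eq (h.mul_x₃_b hq)]
  match_scalars <;> field_simp

theorem mul_u_x₂ (h : IsEnyTuple q x₁ x₂ x₃ b y c u) (hq : q ≠ 0) :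
    u * x₂ = (q⁻¹ ^ 2) • (x₂ * u) - (q⁻¹ ^ 2) • (c * b) := by
  have e := h.x₂_u
  rw [h.mul_b_c hq, sub_sub, sub_eq_zero] at e
  rw [e]; match_scalars <;> field_simp; ring

theorem mul_u_c (h : IsEnyTuple q x₁ x₂ x₃ b y c u) (hq : q ≠ 0) :
    u * c = (q⁻¹ ^ 2) • (c * u) := by
  have e : u * c = u * (x₂ * b) + q • (u * (b * x₂)) := by
    conv_lhs => rw [h.c_eq]
    rw [mul_add, mul_smul_comm]
  have e' : c * u = x₂ * (b * u) + q • (b * (x₂ * u)) := by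
    conv_lhs => rw [h.c_eq]
    rw [add_mul, smul_mul_assoc, mul_assoc, mul_assoc]
  rw [e, e']
  simp only [← h.mul_b_u hq, mul_mul_of_mul_eq (h.mul_b_u hq).symm, h.mul_u_x₂ hq,
    mul_mul_of_mul_eq (h.mul_u_x₂ hq), mul_mul_of_mul_eq (h.mul_b_c hq), h.mul_b_b hq, mul_assoc,
    sub_mul, mul_sub, smul_mul_assoc, mul_smul_comm, mul_zero, smul_zero]
  match_scalars <;> field_simp

theorem mul_u_x₃ (h : IsEnyTuple q x₁ x₂ x₃ b y c u) (hq : q ≠ 0) :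
    u * x₃ = (q ^ 2) • (x₃ * u) := by
  rw [h.mul_x₃_u hq]; match_scalars <;> field_simp

theorem mul_u_y (h : IsEnyTuple q x₁ x₂ x₃ b y c u) (hq : q ≠ 0) :
    u * y = y * u + u * b := by
  have e : u * y = u * (x₂ * x₃) - q • (u * (x₃ * x₂)) := by
    conv_lhs => rw [h.y_eq]
    rw [mul_sub, mul_smul_comm]
  have e' : y * u = x₂ * (x₃ * u) - q • (x₃ * (x₂ * u)) := by
    conv_lhs => rw [h.y_eq]
    rw [sub_mul, smul_mul_assoc, mul_assoc, mul_assoc]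
  rw [e, e']
  simp only [h.mul_u_x₃ hq, mul_mul_of_mul_eq (h.mul_u_x₃ hq), h.mul_u_x₂ hq,
    mul_mul_of_mul_eq (h.mul_u_x₂ hq), mul_mul_of_mul_eq (h.mul_x₃_c hq), h.mul_x₃_b hq,
    h.mul_b_b hq, mul_assoc, sub_mul, mul_sub, add_mul, mul_add, neg_mul, mul_neg,
    smul_mul_assoc, mul_smul_comm, mul_zero, smul_zero]
  match_scalars <;> field_simp <;> ring

theorem mul_c_x₃ (h : IsEnyTuple q x₁ x₂ x₃ b y c u) (hq : q ≠ 0) :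
    c * x₃ = -((2 * q) • (y * b)) + q • u - (q ^ 2) • (x₃ * c) := by
  rw [h.mul_x₃_c hq]; match_scalars <;> field_simp <;> ring

theorem mul_c_y (h : IsEnyTuple q x₁ x₂ x₃ b y c u) (hq : q ≠ 0) :
    c * y = q • (y * c) + c * b := by
  have e : c * y = c * (x₂ * x₃) - q • (c * (x₃ * x₂)) := by
    conv_lhs => rw [h.y_eq]
    rw [mul_sub, mul_smul_comm]
  have e₁ : x₂ * (x₃ * c) = y * c + q • (x₃ * (x₂ * c)) := by
    rw [h.y_eq, sub_mul, smul_mul_assoc, mul_assoc, mul_assoc]; abel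
  have e₂ : x₂ * (y * b) = -(q • (y * (x₂ * b))) := by
    rw [mul_mul_of_mul_eq (h.mul_y_x₂ hq)]
    simp only [neg_mul, smul_mul_assoc, mul_assoc]
    match_scalars <;> field_simp
  rw [e]
  simp only [mul_mul_of_mul_eq (h.mul_c_x₃ hq), h.mul_c_x₃ hq, mul_mul_of_mul_eq (h.mul_c_x₂ hq),
    h.mul_c_x₂ hq, h.mul_b_x₂ hq, h.mul_u_x₂ hq, e₁, e₂, mul_assoc, sub_mul, mul_sub, add_mul,
    mul_add, neg_mul, mul_neg, smul_mul_assoc, mul_smul_comm, mul_zero, smul_zero]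
  match_scalars <;> field_simp <;> ring

theorem mul_y_pow_x₂ (h : IsEnyTuple q x₁ x₂ x₃ b y c u) (hq : q ≠ 0) (n : ℕ) :
    y ^ n * x₂ = ((-1) ^ n * q⁻¹ ^ n) • (x₂ * y ^ n) := by
  induction n with
  | zero => simp
  | succ n ih =>
    rw [pow_succ, mul_assoc, h.mul_y_x₂ hq, mul_neg, mul_smul_comm, mul_mul_of_mul_eq ih,
      smul_mul_assoc, mul_assoc, ← pow_succ]
    match_scalars; ring

theorem mul_b_u_pow (h : IsEnyTuple q x₁ x₂ x₃ b y c u) (hq : q ≠ 0) (n : ℕ) :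
    b * u ^ n = u ^ n * b :=
  Commute.pow_right (h.mul_b_u hq) n

theorem mul_u_pow_c (h : IsEnyTuple q x₁ x₂ x₃ b y c u) (hq : q ≠ 0) (n : ℕ) :
    u ^ n * c = q⁻¹ ^ (2 * n) • (c * u ^ n) := by
  induction n with
  | zero => simp
  | succ n ih =>
    rw [pow_succ, mul_assoc, h.mul_u_c hq, mul_smul_comm, mul_mul_of_mul_eq ih,
      smul_mul_assoc, mul_assoc, ← pow_succ]
    match_scalars; ring

theorem mul_u_pow_x₂ (h : IsEnyTuple q x₁ x₂ x₃ b y c u) (hq : q ≠ 0) (n : ℕ) :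
    u ^ n * x₂ = q⁻¹ ^ (2 * n) • (x₂ * u ^ n) -
      ((n : k) * q⁻¹ ^ (2 * n)) • (c * (u ^ (n - 1) * b)) := by
  induction n with
  | zero => simp
  | succ n ih =>
    have e : (n : k) • u ^ n = (n : k) • (u ^ (n - 1) * u) := by
      rcases n with - | n
      · simp
      · rw [Nat.add_sub_cancel, ← pow_succ]
    have e' : ((n : k) * q⁻¹ ^ (2 * n)) • (c * (u ^ (n - 1) * (b * u))) =
        q⁻¹ ^ (2 * n) • (c * (((n : k) • u ^ n) * b)) := by
      rw [e, h.mul_b_u hq]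
      simp only [smul_mul_assoc, mul_smul_comm, mul_assoc]
      module
    rw [pow_succ, mul_assoc, h.mul_u_x₂ hq, mul_sub, mul_smul_comm, mul_smul_comm,
      mul_mul_of_mul_eq ih, mul_mul_of_mul_eq (h.mul_u_pow_c hq n), Nat.add_sub_cancel, sub_mul,
      smul_mul_assoc, smul_mul_assoc, smul_mul_assoc, mul_assoc, mul_assoc, mul_assoc, mul_assoc,
      e']
    simp only [smul_mul_assoc, mul_smul_comm]
    push_cast
    match_scalars <;> ring

theorem mul_u_pow_y (h : IsEnyTuple q x₁ x₂ x₃ b y c u) (hq : q ≠ 0) (n : ℕ) :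
    u ^ n * y = y * u ^ n + (n : k) • (u ^ n * b) := by
  induction n with
  | zero => simp
  | succ n ih =>
    rw [pow_succ, mul_assoc, h.mul_u_y hq, mul_add, mul_mul_of_mul_eq ih, add_mul,
      smul_mul_assoc, mul_assoc, mul_assoc, h.mul_b_u hq, ← mul_assoc (u ^ n) u b]
    push_cast
    module

end IsEnyTuple

section Spanning

variable {k : Type*} [Field k] {q : k}

theorem isEnyTuple_mkAlgHom (q : k) :
    IsEnyTuple q (RingQuot.mkAlgHom k (enyRel k q) (X k 0))
      (RingQuot.mkAlgHom k (enyRel k q) (X k 1)) (RingQuot.mkAlgHom k (enyRel k q) (X k 2))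
      (RingQuot.mkAlgHom k (enyRel k q) (x13 k q)) (RingQuot.mkAlgHom k (enyRel k q) (x23 k q))
      (RingQuot.mkAlgHom k (enyRel k q) (x213 k q))
      (RingQuot.mkAlgHom k (enyRel k q) (uu k q)) := by
  have key {a : FreeAlgebra k (Fin 3)} (h : enyRel k q a 0) :
      RingQuot.mkAlgHom k (enyRel k q) a = 0 := by
    rw [RingQuot.mkAlgHom_rel k h, map_zero]
  constructor
  · simp [x13]
  · simp [x23]
  · simp [x213]
  · simp [uu]
  · simpa using key (a := X k 0 * X k 0) (by simp [enyRel])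
  · simpa using key (a := X k 1 * X k 1) (by simp [enyRel])
  · simpa using key (a := X k 0 * X k 1 + X k 1 * X k 0) (by simp [enyRel])
  · simpa using key (a := X k 2 * X k 2) (by simp [enyRel])
  · simpa [x31] using key (a := x31 k q * x31 k q) (by simp [enyRel])
  · simpa using key (a := x213 k q * x213 k q) (by simp [enyRel])
  · simpa using key (a := X k 1 * uu k q - (q ^ 2) • (uu k q * X k 1) -
      q • (x13 k q * x213 k q)) (by simp [enyRel])

/-- The image of a coordinate vector under a tuple satisfying the relations. -/
noncomputable def pbwEval {A : Type*} [Ring A] [Algebra k A] (x₁ x₂ x₃ b y c u : A) :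
    (PBWIndex →₀ k) →ₗ[k] A :=
  Finsupp.linearCombination k fun p : PBWIndex =>
    x₂ ^ (p.1 : ℕ) * y ^ p.2.1 * c ^ (p.2.2.1 : ℕ) * u ^ p.2.2.2.1 * x₁ ^ (p.2.2.2.2.1 : ℕ) *
      b ^ (p.2.2.2.2.2.1 : ℕ) * x₃ ^ (p.2.2.2.2.2.2 : ℕ)

namespace IsEnyTuple

variable {A : Type*} [Ring A] [Algebra k A] {x₁ x₂ x₃ b y c u : A}

theorem pbwEval_pbwVec (h : IsEnyTuple q x₁ x₂ x₃ b y c u) (hq : q ≠ 0)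
    (m₁ m₂ m₃ m₄ m₅ m₆ m₇ : ℕ) :
    pbwEval x₁ x₂ x₃ b y c u (pbwVec k m₁ m₂ m₃ m₄ m₅ m₆ m₇) =
      x₂ ^ m₁ * y ^ m₂ * c ^ m₃ * u ^ m₄ * x₁ ^ m₅ * b ^ m₆ * x₃ ^ m₇ := by
  have sq {z : A} (hz : z * z = 0) {m : ℕ} (hm : ¬ m < 2) : z ^ m = 0 :=
    pow_eq_zero_of_le (not_lt.mp hm) ((sq z).trans hz)
  unfold pbwVec
  split_ifs with H
  · simp [pbwEval]
  · by_cases h₁ : m₁ < 2; swap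
    · simp [sq h.x₂_sq h₁]
    by_cases h₃ : m₃ < 2; swap
    · simp [sq h.c_sq h₃]
    by_cases h₅ : m₅ < 2; swap
    · simp [sq h.x₁_sq h₅]
    by_cases h₆ : m₆ < 2; swap
    · simp [sq (h.mul_b_b hq) h₆]
    by_cases h₇ : m₇ < 2; swap
    · simp [sq h.x₃_sq h₇]
    exact absurd ⟨h₁, h₃, h₅, h₆, h₇⟩ H

theorem pbwEval_comp_eq {T : Module.End k (PBWIndex →₀ k)} {z : A}
    (H : ∀ m₁ m₂ m₃ m₄ m₅ m₆ m₇ : ℕ, m₁ < 2 → m₃ < 2 → m₅ < 2 → m₆ < 2 → m₇ < 2 →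
      pbwEval x₁ x₂ x₃ b y c u (T (pbwVec k m₁ m₂ m₃ m₄ m₅ m₆ m₇)) =
        pbwEval x₁ x₂ x₃ b y c u (pbwVec k m₁ m₂ m₃ m₄ m₅ m₆ m₇) * z) (w : PBWIndex →₀ k) :
    pbwEval x₁ x₂ x₃ b y c u (T w) = pbwEval x₁ x₂ x₃ b y c u w * z := by
  have : pbwEval x₁ x₂ x₃ b y c u ∘ₗ T =
      LinearMap.mulRight k z ∘ₗ pbwEval x₁ x₂ x₃ b y c u := by
    refine Finsupp.lhom_ext' fun p => LinearMap.ext_ring ?_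
    simp only [LinearMap.comp_apply, Finsupp.lsingle_apply, single_eq_pbwVec,
      LinearMap.mulRight_apply]
    exact H _ _ _ _ _ _ _ p.1.2 p.2.2.1.2 p.2.2.2.2.1.2 p.2.2.2.2.2.1.2 p.2.2.2.2.2.2.2
  exact LinearMap.congr_fun this w

theorem pbwEval_mulX3 (h : IsEnyTuple q x₁ x₂ x₃ b y c u) (hq : q ≠ 0) (w : PBWIndex →₀ k) :
    pbwEval x₁ x₂ x₃ b y c u (mulX3 w) = pbwEval x₁ x₂ x₃ b y c u w * x₃ := by
  refine pbwEval_comp_eq (fun m₁ m₂ m₃ m₄ m₅ m₆ m₇ h₁ h₃ h₅ h₆ h₇ => ?_) w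
  rw [mulX3, pbwLift_pbwVec _ _ _ _ _ _ _ _ h₁ h₃ h₅ h₆ h₇, h.pbwEval_pbwVec hq,
    h.pbwEval_pbwVec hq, pow_succ, mul_assoc]
  simp only [mul_assoc]

theorem pbwEval_mulX1 (h : IsEnyTuple q x₁ x₂ x₃ b y c u) (hq : q ≠ 0) (w : PBWIndex →₀ k) :
    pbwEval x₁ x₂ x₃ b y c u (mulX1 q w) = pbwEval x₁ x₂ x₃ b y c u w * x₁ := by
  refine pbwEval_comp_eq (fun m₁ m₂ m₃ m₄ m₅ m₆ m₇ h₁ h₃ h₅ h₆ h₇ => ?_) w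
  rw [mulX1, pbwLift_pbwVec _ _ _ _ _ _ _ _ h₁ h₃ h₅ h₆ h₇, mulX1Fun]
  simp only [map_sub, map_smul, h.pbwEval_pbwVec hq, mul_assoc]
  interval_cases m₆ <;> interval_cases m₇ <;>
    simp [pow_succ, mul_assoc, h.mul_x₃_x₁ hq, h.mul_b_x₁ hq, h.mul_b_b hq,
      mul_mul_of_mul_eq (h.mul_b_x₁ hq), mul_sub, smul_smul,
      mul_mul_of_mul_eq (h.mul_b_b hq)]

theorem pbwEval_mulX2 (h : IsEnyTuple q x₁ x₂ x₃ b y c u) (hq : q ≠ 0) (w : PBWIndex →₀ k) :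
    pbwEval x₁ x₂ x₃ b y c u (mulX2 q w) = pbwEval x₁ x₂ x₃ b y c u w * x₂ := by
  refine pbwEval_comp_eq (fun m₁ m₂ m₃ m₄ m₅ m₆ m₇ h₁ h₃ h₅ h₆ h₇ => ?_) w
  have n₁ := mul_mul_of_mul_eq (h.mul_u_pow_x₂ hq m₄)
  have n₂ := mul_mul_of_mul_eq (h.mul_u_pow_c hq m₄)
  have n₃ := mul_mul_of_mul_eq (h.mul_u_pow_y hq m₄)
  have n₄ := mul_mul_of_mul_eq (h.mul_y_pow_x₂ hq m₂)
  have r₁ := mul_mul_of_mul_eq (h.mul_b_x₂ hq)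
  have r₂ := mul_mul_of_mul_eq h.mul_x₁_x₂
  have r₃ := mul_mul_of_mul_eq (h.mul_x₁_c hq)
  have r₄ := mul_mul_of_mul_eq (h.mul_c_x₂ hq)
  have r₅ := mul_mul_of_mul_eq h.mul_b_y
  have r₆ := mul_mul_of_mul_eq h.mul_x₁_y
  have r₇ := mul_mul_of_mul_eq (h.mul_c_y hq)
  have r₈ := mul_mul_of_mul_eq h.c_sq
  have r₉ := mul_mul_of_mul_eq (h.mul_b_b hq)
  have s₁ := mul_mul_of_mul_eq (h.mul_x₁_u hq)
  have s₂ := mul_mul_of_mul_eq (h.mul_b_u hq)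
  have s₃ := mul_mul_of_mul_eq (h.mul_b_x₁ hq)
  have s₄ := mul_mul_of_mul_eq (h.mul_b_c hq)
  have n₅ := mul_mul_of_mul_eq (h.mul_b_u_pow hq m₄)
  interval_cases m₃ <;> interval_cases m₅ <;> interval_cases m₆ <;> interval_cases m₇ <;>
  first
  | rw [mulX2_pbwVec_000 q hq _ _ _ _ h₁ h₃] | rw [mulX2_pbwVec_001 q hq _ _ _ _ h₁ h₃]
  | rw [mulX2_pbwVec_010 q hq _ _ _ _ h₁ h₃] | rw [mulX2_pbwVec_011 q hq _ _ _ _ h₁ h₃]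
  | rw [mulX2_pbwVec_100 q hq _ _ _ _ h₁ h₃] | rw [mulX2_pbwVec_101 q hq _ _ _ _ h₁ h₃]
  | rw [mulX2_pbwVec_110 q hq _ _ _ _ h₁ h₃] | rw [mulX2_pbwVec_111 q hq _ _ _ _ h₁ h₃]
  all_goals
    simp only [map_sub, map_add, map_neg, map_smul, h.pbwEval_pbwVec hq, mul_assoc, pow_zero,
      pow_one, mul_one, one_mul, zero_add, pow_succ, h.mul_x₃_x₂ hq, h.mul_b_x₂ hq,
      h.mul_x₁_x₂, h.mul_u_pow_x₂ hq, h.mul_u_pow_y hq, h.mul_u_pow_c hq, h.mul_y_pow_x₂ hq,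
      h.mul_c_x₂ hq, h.mul_b_y, h.mul_x₁_y, h.mul_c_y hq, h.c_sq, h.mul_b_b hq, h.mul_x₁_c hq,
      h.mul_x₁_u hq, h.mul_b_u hq,
      n₁, n₂, n₅, h.mul_b_u_pow hq, n₃, n₄, r₁, r₂, r₃, r₄, r₅, r₆, r₇, r₈, r₉, s₁, s₂, s₃, s₄,
      h.mul_b_x₁ hq, h.mul_b_c hq, mul_sub, sub_mul, mul_add,
      add_mul, mul_neg, neg_mul, smul_mul_assoc, mul_smul_comm, mul_zero, zero_mul, smul_zero]
  all_goals match_scalars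
  all_goals try simp only [inv_pow]
  all_goals try field_simp
  all_goals try ring1

end IsEnyTuple

end Spanning

section GelfandKirillov

open Filter Topology

theorem tendsto_ofReal_const_div_log_add (C : ℝ) (d : ℕ) :
    Tendsto (fun n : ℕ => ENNReal.ofReal (C / Real.log n + d)) atTop (𝓝 d) := by
  have h : Tendsto (fun n : ℕ => C / Real.log n + d) atTop (𝓝 (0 + d)) :=
    ((tendsto_const_nhds (x := C)).div_atTop
      (Real.tendsto_log_atTop.comp tendsto_natCast_atTop_atTop)).add tendsto_const_nhds
  rw [zero_add] at h
  simpa using ENNReal.tendsto_ofReal h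

theorem log_mul_pow_div_log {C : ℝ} (hC : 0 < C) (d : ℕ) {n : ℕ} (hn : 2 ≤ n) :
    Real.log (C * (n : ℝ) ^ d) / Real.log n = Real.log C / Real.log n + d := by
  have hn' : (1 : ℝ) < n := by exact_mod_cast hn
  have hl : Real.log n ≠ 0 := (Real.log_pos hn').ne'
  rw [Real.log_mul hC.ne' (by positivity), Real.log_pow, add_div, mul_div_cancel_right₀ _ hl]

variable {k A : Type*} [Field k] [Ring A] [Algebra k A]

theorem GKdim_le_natCast (d : ℕ)
    (h : ∀ V : Submodule k A, FiniteDimensional k V → ∃ C : ℝ, 1 ≤ C ∧ ∀ n : ℕ, 1 ≤ n →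
      (Module.finrank k (↥(∑ j ∈ Finset.range (n + 1), V ^ j)) : ℝ) ≤ C * (n : ℝ) ^ d) :
    GKdim k A ≤ d := by
  refine iSup₂_le fun V hV => ?_
  obtain ⟨C, hC, hle⟩ := h V hV
  rw [← (tendsto_ofReal_const_div_log_add (Real.log C) d).limsup_eq]
  refine limsup_le_limsup ?_
  filter_upwards [eventually_ge_atTop 2] with n hn
  rw [← log_mul_pow_div_log (by positivity) d hn]
  have hn' : (1 : ℝ) ≤ n := by exact_mod_cast (by lia : 1 ≤ n)
  refine ENNReal.ofReal_le_ofReal (div_le_div_of_nonneg_right ?_ (Real.log_nonneg hn'))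
  rcases Nat.eq_zero_or_pos (Module.finrank k (↥(∑ j ∈ Finset.range (n + 1), V ^ j)))
    with h0 | h0
  · rw [h0, Nat.cast_zero, Real.log_zero]
    exact Real.log_nonneg (one_le_mul_of_one_le_of_one_le hC (one_le_pow₀ hn'))
  · exact Real.log_le_log (by exact_mod_cast h0) (hle n (by lia))

theorem natCast_le_GKdim (d : ℕ) (V : Submodule k A) [FiniteDimensional k V] {C : ℝ}
    (hC : 0 < C) (h : ∀ n : ℕ, 1 ≤ n →
      C * (n : ℝ) ^ d ≤ Module.finrank k (↥(∑ j ∈ Finset.range (n + 1), V ^ j))) :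
    d ≤ GKdim k A := by
  refine le_iSup₂_of_le V inferInstance ?_
  rw [← (tendsto_ofReal_const_div_log_add (Real.log C) d).limsup_eq]
  refine limsup_le_limsup ?_
  filter_upwards [eventually_ge_atTop 2] with n hn
  rw [← log_mul_pow_div_log hC d hn]
  have hn' : (1 : ℝ) ≤ n := by exact_mod_cast (by lia : 1 ≤ n)
  exact ENNReal.ofReal_le_ofReal (div_le_div_of_nonneg_right
    (Real.log_le_log (by positivity) (h n (by lia))) (Real.log_nonneg hn'))

theorem exists_le_pow_of_finiteDimensional {S : Submodule k A} (hS : 1 ≤ S)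
    (hex : ∀ a : A, ∃ n : ℕ, a ∈ S ^ n) (V : Submodule k A) [FiniteDimensional k V] :
    ∃ d : ℕ, V ≤ S ^ d := by
  obtain ⟨s, rfl⟩ := (Submodule.fg_iff_finiteDimensional V).mpr inferInstance
  choose f hf using hex
  refine ⟨s.sup f, Submodule.span_le.mpr fun a ha => ?_⟩
  exact pow_le_pow_right₀ hS (Finset.le_sup ha) (hf a)

theorem sum_pow_le_pow {S : Submodule k A} (hS : 1 ≤ S) {V : Submodule k A} {d : ℕ}
    (hV : V ≤ S ^ d) (n : ℕ) : ∑ j ∈ Finset.range (n + 1), V ^ j ≤ S ^ (d * n) := by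
  refine Finset.sum_induction (fun j => V ^ j) (· ≤ S ^ (d * n)) (fun _ _ => sup_le) bot_le
    fun j hj => ?_
  refine (pow_le_pow_left' hV j).trans ?_
  rw [← pow_mul]
  exact pow_le_pow_right₀ hS (Nat.mul_le_mul_left d (Finset.mem_range_succ_iff.mp hj))

end GelfandKirillov

section Growth

variable {k : Type*} [Field k]

/-- The exponents whose unbounded entries are at most `n`. -/
def pbwBox (n : ℕ) : Finset PBWIndex :=
  Finset.univ ×ˢ Finset.range (n + 1) ×ˢ Finset.univ ×ˢ Finset.range (n + 1) ×ˢ Finset.univ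

theorem card_pbwBox (n : ℕ) : (pbwBox n).card = 32 * (n + 1) ^ 2 := by
  simp only [pbwBox, Finset.card_product, Finset.card_univ, Finset.card_range, Fintype.card_fin,
    Fintype.card_prod]
  ring

theorem pbwVec_mem_supported {m₁ m₂ m₃ m₄ m₅ m₆ m₇ n : ℕ} (h₂ : m₂ ≤ n) (h₄ : m₄ ≤ n) :
    pbwVec k m₁ m₂ m₃ m₄ m₅ m₆ m₇ ∈ Finsupp.supported k k (pbwBox n : Set PBWIndex) := by
  unfold pbwVec
  split_ifs
  · exact Finsupp.single_mem_supported _ _ (by simp [pbwBox]; lia)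
  · exact zero_mem _

theorem pbwLift_mem_supported {f : ℕ → ℕ → ℕ → ℕ → ℕ → ℕ → ℕ → (PBWIndex →₀ k)} {n : ℕ}
    (hf : ∀ m₁ m₂ m₃ m₄ m₅ m₆ m₇, m₂ ≤ n → m₄ ≤ n →
      f m₁ m₂ m₃ m₄ m₅ m₆ m₇ ∈ Finsupp.supported k k (pbwBox (n + 1) : Set PBWIndex))
    {w : PBWIndex →₀ k} (hw : w ∈ Finsupp.supported k k (pbwBox n : Set PBWIndex)) :
    pbwLift f w ∈ Finsupp.supported k k (pbwBox (n + 1) : Set PBWIndex) := by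
  rw [pbwLift, Finsupp.linearCombination_apply]
  refine Submodule.sum_mem _ fun p hp => Submodule.smul_mem _ _ ?_
  have hp' : p ∈ pbwBox n := (Finsupp.mem_supported k w).mp hw hp
  simp only [pbwBox, Finset.mem_product, Finset.mem_range, Finset.mem_univ, true_and,
    and_true] at hp'
  exact hf _ _ _ _ _ _ _ (by lia) (by lia)

variable (q : k) {n : ℕ} {w : PBWIndex →₀ k}

theorem mulX1_mem_supported (hw : w ∈ Finsupp.supported k k (pbwBox n : Set PBWIndex)) :
    mulX1 q w ∈ Finsupp.supported k k (pbwBox (n + 1) : Set PBWIndex) := by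
  refine pbwLift_mem_supported (fun m₁ m₂ m₃ m₄ m₅ m₆ m₇ h₂ h₄ => ?_) hw
  exact sub_mem (Submodule.smul_mem _ _ (pbwVec_mem_supported (by lia) (by lia)))
    (Submodule.smul_mem _ _ (pbwVec_mem_supported (by lia) (by lia)))

theorem mulX3_mem_supported (hw : w ∈ Finsupp.supported k k (pbwBox n : Set PBWIndex)) :
    mulX3 w ∈ Finsupp.supported k k (pbwBox (n + 1) : Set PBWIndex) :=
  pbwLift_mem_supported (fun _ _ _ _ _ _ _ _ _ => pbwVec_mem_supported (by lia) (by lia)) hw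

theorem mulX2_mem_supported (hw : w ∈ Finsupp.supported k k (pbwBox n : Set PBWIndex)) :
    mulX2 q w ∈ Finsupp.supported k k (pbwBox (n + 1) : Set PBWIndex) := by
  refine pbwLift_mem_supported (fun m₁ m₂ m₃ m₄ m₅ m₆ m₇ h₂ h₄ => ?_) hw
  have key {a b c d e f g : ℕ} (r : k) (hb : b ≤ n + 1) (hd : d ≤ n + 1) :
      r • pbwVec k a b c d e f g ∈ Finsupp.supported k k (pbwBox (n + 1) : Set PBWIndex) :=
    Submodule.smul_mem _ _ (pbwVec_mem_supported hb hd)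
  refine sub_mem (add_mem (sub_mem ?_ ?_) ?_) (Submodule.smul_mem _ _
    (add_mem (add_mem (sub_mem ?_ ?_) ?_) ?_)) <;> exact key _ (by lia) (by lia)

/-- The span of `1` and the generators. -/
noncomputable def generatingSpace (q : k) : Submodule k (RingQuot (enyRel k q)) :=
  Submodule.span k {1, RingQuot.mkAlgHom k (enyRel k q) (X k 0),
    RingQuot.mkAlgHom k (enyRel k q) (X k 1), RingQuot.mkAlgHom k (enyRel k q) (X k 2)}

instance : FiniteDimensional k (generatingSpace q) :=
  FiniteDimensional.span_of_finite k (Set.toFinite _)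

theorem mkAlgHom_X_mem_generatingSpace (i : Fin 3) :
    RingQuot.mkAlgHom k (enyRel k q) (X k i) ∈ generatingSpace q := by
  refine Submodule.subset_span ?_
  fin_cases i <;> simp

theorem one_le_generatingSpace : 1 ≤ generatingSpace q :=
  Submodule.one_le.mpr (Submodule.subset_span (by simp))

theorem exists_mem_generatingSpace_pow (a : RingQuot (enyRel k q)) :
    ∃ n : ℕ, a ∈ generatingSpace q ^ n := by
  obtain ⟨a, rfl⟩ := RingQuot.mkAlgHom_surjective k (enyRel k q) a
  induction a using FreeAlgebra.induction with
  | grade0 r => exact ⟨0, by simp⟩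
  | grade1 i => exact ⟨1, by rw [pow_one]; exact mkAlgHom_X_mem_generatingSpace q i⟩
  | mul a b ha hb =>
    obtain ⟨m, hm⟩ := ha
    obtain ⟨n, hn⟩ := hb
    exact ⟨m + n, by rw [map_mul, pow_add]; exact Submodule.mul_mem_mul hm hn⟩
  | add a b ha hb =>
    obtain ⟨m, hm⟩ := ha
    obtain ⟨n, hn⟩ := hb
    refine ⟨max m n, ?_⟩
    rw [map_add]
    exact add_mem (pow_le_pow_right₀ (one_le_generatingSpace q) (le_max_left m n) hm)
      (pow_le_pow_right₀ (one_le_generatingSpace q) (le_max_right m n) hn)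

theorem bas_eq (p : PBWIndex) : bas k q p =
    RingQuot.mkAlgHom k (enyRel k q) (X k 1) ^ (p.1 : ℕ) *
      RingQuot.mkAlgHom k (enyRel k q) (x23 k q) ^ p.2.1 *
      RingQuot.mkAlgHom k (enyRel k q) (x213 k q) ^ (p.2.2.1 : ℕ) *
      RingQuot.mkAlgHom k (enyRel k q) (uu k q) ^ p.2.2.2.1 *
      RingQuot.mkAlgHom k (enyRel k q) (X k 0) ^ (p.2.2.2.2.1 : ℕ) *
      RingQuot.mkAlgHom k (enyRel k q) (x13 k q) ^ (p.2.2.2.2.2.1 : ℕ) *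
      RingQuot.mkAlgHom k (enyRel k q) (X k 2) ^ (p.2.2.2.2.2.2 : ℕ) := by
  simp only [bas, map_mul, map_pow]

theorem mul_mem_map_supported {x : RingQuot (enyRel k q)} {T : Module.End k (PBWIndex →₀ k)}
    (hT : ∀ w, Finsupp.linearCombination k (bas k q) (T w) =
      Finsupp.linearCombination k (bas k q) w * x)
    (hT' : ∀ w, w ∈ Finsupp.supported k k (pbwBox n : Set PBWIndex) →
      T w ∈ Finsupp.supported k k (pbwBox (n + 1) : Set PBWIndex))
    {a : RingQuot (enyRel k q)}
    (ha : a ∈ (Finsupp.supported k k (pbwBox n : Set PBWIndex)).map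
      (Finsupp.linearCombination k (bas k q))) :
    a * x ∈ (Finsupp.supported k k (pbwBox (n + 1) : Set PBWIndex)).map
      (Finsupp.linearCombination k (bas k q)) := by
  obtain ⟨w, hw, rfl⟩ := ha
  exact ⟨T w, hT' w hw, hT w⟩

theorem generatingSpace_pow_le (hq : q ≠ 0) (n : ℕ) :
    generatingSpace q ^ n ≤ (Finsupp.supported k k (pbwBox n : Set PBWIndex)).map
      (Finsupp.linearCombination k (bas k q)) := by
  have hev : Finsupp.linearCombination k (bas k q) = pbwEval _ _ _ _ _ _ _ :=
    congrArg _ (funext (bas_eq q))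
  have h := isEnyTuple_mkAlgHom q
  induction n with
  | zero =>
    rw [pow_zero, Submodule.one_le]
    refine ⟨pbwVec k 0 0 0 0 0 0 0, pbwVec_mem_supported le_rfl le_rfl, ?_⟩
    rw [hev, h.pbwEval_pbwVec hq]
    simp
  | succ n ih =>
    rw [pow_succ, Submodule.mul_le]
    intro a ha x hx
    replace ha := ih ha
    induction hx using Submodule.span_induction with
    | zero => rw [mul_zero]; exact zero_mem _
    | add x y _ _ hx hy => rw [mul_add]; exact add_mem hx hy
    | smul r x _ hx => rw [mul_smul_comm]; exact Submodule.smul_mem _ _ hx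
    | mem x hx =>
      obtain rfl | rfl | rfl | rfl := hx
      · rw [mul_one]
        refine Submodule.map_mono (Finsupp.supported_mono ?_) ha
        intro p hp
        simp only [pbwBox, Finset.coe_product, Set.mem_prod, Finset.mem_coe,
          Finset.mem_range, Finset.mem_univ] at hp ⊢
        lia
      · exact mul_mem_map_supported q (fun w => by rw [hev]; exact h.pbwEval_mulX1 hq w)
          (fun w => mulX1_mem_supported q) ha
      · exact mul_mem_map_supported q (fun w => by rw [hev]; exact h.pbwEval_mulX2 hq w)
          (fun w => mulX2_mem_supported q) ha
      · exact mul_mem_map_supported q (fun w => by rw [hev]; exact h.pbwEval_mulX3 hq w)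
          (fun w => mulX3_mem_supported) ha

theorem span_range_bas (hq : q ≠ 0) : Submodule.span k (Set.range (bas k q)) = ⊤ := by
  refine eq_top_iff.mpr fun a _ => ?_
  obtain ⟨n, hn⟩ := exists_mem_generatingSpace_pow q a
  obtain ⟨w, -, rfl⟩ := generatingSpace_pow_le q hq n hn
  rw [← Finsupp.range_linearCombination]
  exact LinearMap.mem_range_self _ _

instance (n : ℕ) : FiniteDimensional k (Finsupp.supported k k (pbwBox n : Set PBWIndex)) :=
  Module.Finite.equiv (Finsupp.supportedEquivFinsupp (pbwBox n : Set PBWIndex)).symm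

theorem finrank_supported_pbwBox (n : ℕ) :
    Module.finrank k (Finsupp.supported k k (pbwBox n : Set PBWIndex)) = 32 * (n + 1) ^ 2 := by
  rw [(Finsupp.supportedEquivFinsupp (pbwBox n : Set PBWIndex)).finrank_eq,
    Module.finrank_finsupp_self]
  exact (Fintype.card_coe (pbwBox n)).trans (card_pbwBox n)

theorem GKdim_le_two (hq : q ≠ 0) : GKdim k (RingQuot (enyRel k q)) ≤ 2 := by
  refine GKdim_le_natCast 2 fun V hV => ?_
  obtain ⟨d, hd⟩ := exists_le_pow_of_finiteDimensional (one_le_generatingSpace q)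
    (exists_mem_generatingSpace_pow q) V
  refine ⟨32 * ((d : ℝ) + 1) ^ 2, ?_, fun n hn => ?_⟩
  · nlinarith [(Nat.cast_nonneg d : (0 : ℝ) ≤ d)]
  have h₁ := (sum_pow_le_pow (one_le_generatingSpace q) hd n).trans
    (generatingSpace_pow_le q hq (d * n))
  have h₂ := (Submodule.finrank_mono h₁).trans (Submodule.finrank_map_le _ _)
  rw [finrank_supported_pbwBox] at h₂
  have h₃ : 32 * (d * n + 1) ^ 2 ≤ 32 * (d + 1) ^ 2 * n ^ 2 := by
    rw [mul_assoc, ← mul_pow]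
    gcongr
    nlinarith
  exact_mod_cast h₂.trans h₃

theorem mkAlgHom_mul_mem {a b : FreeAlgebra k (Fin 3)} {i j : ℕ}
    (ha : RingQuot.mkAlgHom k (enyRel k q) a ∈ generatingSpace q ^ i)
    (hb : RingQuot.mkAlgHom k (enyRel k q) b ∈ generatingSpace q ^ j) :
    RingQuot.mkAlgHom k (enyRel k q) (a * b) ∈ generatingSpace q ^ (i + j) := by
  rw [map_mul, pow_add]
  exact Submodule.mul_mem_mul ha hb

theorem mkAlgHom_X_mem (i : Fin 3) :
    RingQuot.mkAlgHom k (enyRel k q) (X k i) ∈ generatingSpace q ^ 1 := by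
  rw [pow_one]
  exact mkAlgHom_X_mem_generatingSpace q i

theorem mkAlgHom_x13_mem :
    RingQuot.mkAlgHom k (enyRel k q) (x13 k q) ∈ generatingSpace q ^ 2 := by
  rw [x13, map_sub, map_smul]
  exact sub_mem (mkAlgHom_mul_mem q (mkAlgHom_X_mem q 0) (mkAlgHom_X_mem q 2))
    (Submodule.smul_mem _ _ (mkAlgHom_mul_mem q (mkAlgHom_X_mem q 2) (mkAlgHom_X_mem q 0)))

theorem mkAlgHom_x23_mem :
    RingQuot.mkAlgHom k (enyRel k q) (x23 k q) ∈ generatingSpace q ^ 2 := by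
  rw [x23, map_sub, map_smul]
  exact sub_mem (mkAlgHom_mul_mem q (mkAlgHom_X_mem q 1) (mkAlgHom_X_mem q 2))
    (Submodule.smul_mem _ _ (mkAlgHom_mul_mem q (mkAlgHom_X_mem q 2) (mkAlgHom_X_mem q 1)))

theorem mkAlgHom_uu_mem :
    RingQuot.mkAlgHom k (enyRel k q) (uu k q) ∈ generatingSpace q ^ 4 := by
  rw [uu, map_add]
  exact add_mem (mkAlgHom_mul_mem q (mkAlgHom_x23_mem q) (mkAlgHom_x13_mem q))
    (mkAlgHom_mul_mem q (mkAlgHom_x13_mem q) (mkAlgHom_x23_mem q))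

theorem bas_mem_generatingSpace_pow {i j n : ℕ} (h : 2 * i + 4 * j ≤ n) :
    bas k q (0, i, 0, j, 0, 0, 0) ∈ generatingSpace q ^ n := by
  refine pow_le_pow_right₀ (one_le_generatingSpace q) h ?_
  rw [pow_add, pow_mul, pow_mul]
  simpa [bas_eq] using Submodule.mul_mem_mul (Submodule.pow_mem_pow _ (mkAlgHom_x23_mem q) i)
    (Submodule.pow_mem_pow _ (mkAlgHom_uu_mem q) j)

theorem two_le_GKdim (hq : q ≠ 0) : 2 ≤ GKdim k (RingQuot (enyRel k q)) := by
  refine natCast_le_GKdim 2 (generatingSpace q) (C := (1 / 8) ^ 2) (by norm_num) fun n _ => ?_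
  set W := ∑ j ∈ Finset.range (n + 1), generatingSpace q ^ j with hW
  have hle : W ≤ generatingSpace q ^ (1 * n) :=
    sum_pow_le_pow (one_le_generatingSpace q) (pow_one _).ge n
  have hge : generatingSpace q ^ n ≤ W :=
    Finset.single_le_sum (f := fun j => generatingSpace q ^ j) (fun _ _ => bot_le)
      (Finset.self_mem_range_succ n)
  have : FiniteDimensional k W :=
    Submodule.finiteDimensional_of_le (hle.trans (generatingSpace_pow_le q hq _))
  let v : Fin (n / 8 + 1) × Fin (n / 8 + 1) → W := fun p =>
    ⟨bas k q (0, p.1, 0, p.2, 0, 0, 0), hge (bas_mem_generatingSpace_pow q (by lia))⟩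
  have hv : LinearIndependent k v := by
    refine LinearIndependent.of_comp W.subtype ?_
    refine (linearIndependent_bas hq).comp
      (fun p : Fin (n / 8 + 1) × Fin (n / 8 + 1) => ((0, p.1, 0, p.2, 0, 0, 0) : PBWIndex)) ?_
    rintro ⟨i, j⟩ ⟨i', j'⟩ h
    simpa [Fin.ext_iff] using h
  have hcard := hv.fintype_card_le_finrank
  rw [Fintype.card_prod, Fintype.card_fin] at hcard
  have h₁ : (n : ℝ) / 8 ≤ (n / 8 + 1 : ℕ) := by
    rw [div_le_iff₀ (by norm_num)]
    exact_mod_cast (by lia : n ≤ (n / 8 + 1) * 8)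
  calc (1 / 8 : ℝ) ^ 2 * (n : ℝ) ^ 2 = (n / 8) ^ 2 := by ring
    _ ≤ ((n / 8 + 1 : ℕ) : ℝ) ^ 2 := by gcongr
    _ ≤ _ := by rw [sq]; exact_mod_cast hcard

end Growth

/-- The PBW monomials form a basis of `B(eny⋆(q))`, and
`GKdim B(eny⋆(q)) = 2`. -/
theorem statement17 (k : Type*) [Field k] [IsAlgClosed k] [CharZero k]
    (q : k) (hq : q ≠ 0) :
    (LinearIndependent k (bas k q) ∧
      Submodule.span k (Set.range (bas k q)) = ⊤) ∧
    GKdim k (RingQuot (enyRel k q)) = 2 := by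
  exact ⟨⟨linearIndependent_bas hq, span_range_bas q hq⟩,
    le_antisymm (GKdim_le_two q hq) (two_le_GKdim q hq)⟩
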